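/- Let 𝒜 ⊆ ℂ^N be an irreducible algebraic set of positive dimension (equivalently, infinite) and let f : 𝒜 → ℂ^M be a proper holomorphic mapping on 𝒜. Let a ∈ 𝒜 and δ > 0 and put E := 𝒜 ∩ B̄(a,δ) (B̄ the closed Euclidean ball). If there exists d > 0 such that V_{f(E)}(f(z)) ≤ d · V_E(z) for all z ∈ 𝒜, then limsup_{𝒜∋z→∞} log‖f(z)‖/log‖z‖ ≤ d, i.e. the growth exponent satisfies ρ(f,𝒜) ≤ d. -/

import Mathlib

open Filter MvPolynomial Metric Set ENNReal

/-- extended logarithm of a nonnegative real number, with `elog 0 = -∞`. -/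
noncomputable def elog (t : ℝ) : EReal := if t = 0 then ⊥ else ((Real.log t : ℝ) : EReal)

/-- the filter of points of `V` whose norm tends to infinity. -/
def atInftyOn {E : Type*} [Norm E] (V : Set E) : Filter E :=
  (Filter.comap (fun z => ‖z‖) Filter.atTop) ⊓ Filter.principal V

/-- the quotient `log ‖f z‖ / log ‖z‖`, computed in the extended reals. -/
noncomputable def logRatio {E F : Type*} [Norm E] [Norm F] (f : E → F) (z : E) : EReal :=
  elog ‖f z‖ / elog ‖z‖

/-- the growth exponent `ρ(f, V)` of `f` on `V`. -/
noncomputable def growthExp {E F : Type*} [Norm E] [Norm F] (f : E → F) (V : Set E) : EReal :=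
  Filter.limsup (logRatio f) (atInftyOn V)

/-- `log ‖f⁻¹(w)‖ = log sup {‖z‖ : z ∈ V, f z = w}`, computed in the extended reals
(`-∞` for an empty fiber). -/
noncomputable def fiberLogNorm {E F : Type*} [Norm E] [Norm F] (f : E → F) (V : Set E)
    (w : F) : EReal :=
  sSup ((fun z => elog ‖z‖) '' {z | z ∈ V ∧ f z = w})

/-- the order `ρ(f⁻¹, f(V))` of `f` on `V`: the growth exponent of the multifunction `f⁻¹`
on `f(V)`. -/
noncomputable def orderExp {E F : Type*} [Norm E] [Norm F] (f : E → F) (V : Set E) : EReal :=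
  Filter.limsup (fun w => fiberLogNorm f V w / elog ‖w‖) (atInftyOn (f '' V))

/-- the Łojasiewicz exponent at infinity `L∞(f|V)`, with `sup ∅ = -∞`. -/
noncomputable def lojExp {E F : Type*} [Norm E] [Norm F] (f : E → F) (V : Set E) : EReal :=
  sSup {x : EReal | ∃ d : ℝ, x = (d : EReal) ∧
    ∃ C : ℝ, 0 < C ∧ ∃ R : ℝ, 0 < R ∧ ∀ z ∈ V, R < ‖z‖ → C * ‖z‖ ^ d < ‖f z‖}

/-- inverse on `[0,+∞] ⊆ EReal` with the conventions `1/∞ = 0` and `1/0 = ∞`. -/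
noncomputable def invE (x : EReal) : EReal :=
  if x = ⊤ then 0 else if x = 0 then ⊤ else (((x.toReal)⁻¹ : ℝ) : EReal)

/-- evaluation of a polynomial of `n` variables at a point of `ℂⁿ`. -/
noncomputable def evalAt {n : ℕ} (z : EuclideanSpace ℂ (Fin n))
    (p : MvPolynomial (Fin n) ℂ) : ℂ :=
  MvPolynomial.eval (fun i => z i) p

/-- an algebraic subset of `ℂⁿ`: the common zero set of finitely many polynomials. -/
def IsAlgebraicSet {n : ℕ} (A : Set (EuclideanSpace ℂ (Fin n))) : Prop :=
  ∃ S : Finset (MvPolynomial (Fin n) ℂ), A = {z | ∀ p ∈ S, evalAt z p = 0}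

/-- the ideal of all polynomials vanishing identically on `A`. -/
noncomputable def vanishIdeal {n : ℕ} (A : Set (EuclideanSpace ℂ (Fin n))) :
    Ideal (MvPolynomial (Fin n) ℂ) :=
  RingHom.ker (Pi.ringHom fun z : A =>
    MvPolynomial.eval (fun i => (z : EuclideanSpace ℂ (Fin n)) i))

/-- a polynomial mapping on `A`: the restriction to `A` of a mapping all of whose
components are polynomials. -/
def IsPolyMapOn {N M : ℕ} (f : EuclideanSpace ℂ (Fin N) → EuclideanSpace ℂ (Fin M))
    (A : Set (EuclideanSpace ℂ (Fin N))) : Prop :=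
  ∃ P : Fin M → MvPolynomial (Fin N) ℂ, ∀ z ∈ A, ∀ j, f z j = evalAt z (P j)

/-- a holomorphic mapping on `A`: locally the restriction of a holomorphic mapping on an
open subset of the ambient space. -/
def IsHoloOn {N M : ℕ} (f : EuclideanSpace ℂ (Fin N) → EuclideanSpace ℂ (Fin M))
    (A : Set (EuclideanSpace ℂ (Fin N))) : Prop :=
  ∀ z ∈ A, ∃ U : Set (EuclideanSpace ℂ (Fin N)), IsOpen U ∧ z ∈ U ∧
    ∃ F : EuclideanSpace ℂ (Fin N) → EuclideanSpace ℂ (Fin M),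
      DifferentiableOn ℂ F U ∧ Set.EqOn f F (U ∩ A)

/-- the pluricomplex Green function of a compact set `K ⊆ ℂⁿ`, in its Siciak–Zaharjuta
polynomial form `V_K(z) = sup { (deg q)⁻¹ · log⁺ |q(z)| }`. -/
noncomputable def greenV {n : ℕ} (K : Set (EuclideanSpace ℂ (Fin n)))
    (z : EuclideanSpace ℂ (Fin n)) : EReal :=
  sSup {x : EReal | ∃ q : MvPolynomial (Fin n) ℂ, 1 ≤ q.totalDegree ∧
    (∀ w ∈ K, ‖evalAt w q‖ ≤ 1) ∧
    x = (((q.totalDegree : ℝ)⁻¹ * max (Real.log ‖evalAt z q‖) 0 : ℝ) : EReal)}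

section
open scoped Topology
namespace BW

/-- one-variable Bernstein–Walsh -/
lemma bw_one (g : Polynomial ℂ) (n : ℕ) (hn : g.natDegree ≤ n) (r K : ℝ) (hr : 0 < r) (hr1 : r ≤ 1)
    (hg : ∀ t : ℂ, ‖t‖ ≤ r → ‖g.eval t‖ ≤ K) : ‖g.eval 1‖ ≤ (2 / r) ^ n * K := by
  have hK : 0 ≤ K := (norm_nonneg _).trans (hg 0 (by simpa using hr.le))
  have hc : ∀ i, ‖g.coeff i‖ ≤ K / r ^ i := by
    intro i
    have h1 := Complex.norm_iteratedDeriv_le_of_forall_mem_sphere_norm_le (f := fun t => g.eval t)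
      (c := 0) (R := r) (C := K) i hr g.differentiable.diffContOnCl
      (fun z hz => hg z (by simpa using (mem_sphere_iff_norm.1 hz).le))
    have h2 : iteratedDeriv i (fun t => g.eval t) 0 = (i.factorial : ℂ) * g.coeff i := by
      have h3 : iteratedDeriv i (fun t => g.eval t) = fun t => ((Polynomial.derivative)^[i] g).eval t := by
        clear h1
        induction i with
        | zero => simp
        | succ i ih =>
          rw [iteratedDeriv_succ, ih]
          ext t
          rw [Polynomial.deriv, Function.iterate_succ_apply']
      rw [h3]
      simp only
      rw [← Polynomial.coeff_zero_eq_eval_zero, Polynomial.coeff_iterate_derivative]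
      simp [Nat.descFactorial_self]
    rw [h2, norm_mul] at h1
    have h4 : (0:ℝ) < i.factorial := by exact_mod_cast i.factorial_pos
    simp only [Complex.norm_natCast] at h1
    rw [mul_div_assoc] at h1
    exact le_of_mul_le_mul_left h1 h4
  rw [Polynomial.eval_eq_sum_range' (Nat.lt_succ_of_le hn)]
  calc _ ≤ ∑ i ∈ Finset.range (n+1), ‖g.coeff i * 1 ^ i‖ := norm_sum_le _ _
    _ ≤ ∑ i ∈ Finset.range (n+1), K / r ^ n := by
        refine Finset.sum_le_sum fun i hi => ?_
        simp only [one_pow, mul_one]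
        refine (hc i).trans ?_
        have : r ^ n ≤ r ^ i := pow_le_pow_of_le_one hr.le hr1 (by simpa [Nat.lt_succ_iff] using hi)
        gcongr
    _ = (n+1) * (K / r ^ n) := by simp
    _ ≤ 2 ^ n * (K / r ^ n) := by
        gcongr
        exact_mod_cast Nat.lt_two_pow_self (n := n)
    _ = _ := by rw [div_pow]; ring

lemma line_poly {k : ℕ} (p : MvPolynomial (Fin k) ℂ) (x v : Fin k → ℂ) :
    ∃ g : Polynomial ℂ, g.natDegree ≤ p.totalDegree ∧ ∀ t, g.eval t = eval (x + t • v) p := by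
  refine ⟨aeval (fun i => Polynomial.C (x i) + Polynomial.C (v i) * Polynomial.X) p, ?_, ?_⟩
  · have := MvPolynomial.aeval_natDegree_le (m := p.totalDegree) p le_rfl
      (fun i => Polynomial.C (x i) + Polynomial.C (v i) * Polynomial.X) (n := 1) (fun i => by
        compute_degree)
    simpa using this
  · intro t
    rw [← Polynomial.coe_aeval_eq_eval]
    rw [MvPolynomial.comp_aeval_apply, ← MvPolynomial.aeval_eq_eval]
    have : (fun i => (Polynomial.aeval t) (Polynomial.C (x i) + Polynomial.C (v i) * Polynomial.X))
        = x + t • v := by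
      ext i
      simp [mul_comm (v i) t]
    rw [this]

lemma bw_multi {k : ℕ} (x0 : Fin k → ℂ) (ρ R : ℝ) (hρ : 0 < ρ) :
    ∃ C : ℝ, 1 ≤ C ∧ ∀ (n : ℕ) (p : MvPolynomial (Fin k) ℂ), p.totalDegree ≤ n → ∀ K : ℝ,
      (∀ x ∈ ball x0 ρ, ‖eval x p‖ ≤ K) → ∀ x, ‖x‖ ≤ R → ‖eval x p‖ ≤ C ^ n * K := by
  set s := |R| + ‖x0‖ + ρ
  have hs : 0 < s := by positivity
  have hr : 0 < ρ / (2 * s) := by positivity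
  have hr1 : ρ / (2 * s) ≤ 1 := by
    rw [div_le_one (by positivity)]
    have := abs_nonneg R
    have := norm_nonneg x0
    simp only [s]; linarith
  refine ⟨2 / (ρ / (2 * s)), ?_, ?_⟩
  · rw [one_le_div hr]; linarith
  · intro n p hp K hK x hx
    obtain ⟨g, hg, hg'⟩ := line_poly p x0 (x - x0)
    have := bw_one g n (hg.trans hp) _ K hr hr1 (fun t ht => by
      rw [hg']
      apply hK
      rw [mem_ball, dist_eq_norm, add_sub_cancel_left, norm_smul]
      have h1 : ‖x - x0‖ ≤ s := by
        have := norm_sub_le x x0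
        have := le_abs_self R
        simp only [s]; linarith
      calc _ ≤ ρ / (2*s) * s := by gcongr
        _ = ρ / 2 := by field_simp
        _ < ρ := by linarith)
    rw [hg'] at this
    simpa using this

/-- three circles -/
lemma three_circles (g : ℂ → ℂ) (ε R a b : ℝ) (hε : 0 < ε) (hR : ε < R)
    (hg : ∀ t, ‖t‖ ≤ R → DifferentiableAt ℂ g t)
    (ha : ∀ t, ‖t‖ ≤ ε → ‖g t‖ ≤ a) (hb : ∀ t, ‖t‖ ≤ R → ‖g t‖ ≤ b) (t : ℂ) (h1 : ε ≤ ‖t‖)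
    (h2 : ‖t‖ ≤ R) :
    ‖g t‖ ≤ a ^ (1 - (Real.log ‖t‖ - Real.log ε) / (Real.log R - Real.log ε)) *
      b ^ ((Real.log ‖t‖ - Real.log ε) / (Real.log R - Real.log ε)) := by
  have hRp : 0 < R := hε.trans hR
  have htp : 0 < ‖t‖ := hε.trans_le h1
  have ht0 : t ≠ 0 := norm_pos_iff.1 htp
  have hlog : Real.log ε < Real.log R := Real.log_lt_log hε hR
  have hnorm : ∀ w : ℂ, w.re ≤ Real.log R → ‖Complex.exp w‖ ≤ R := by
    intro w hw
    rw [Complex.norm_exp]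
    calc _ ≤ Real.exp (Real.log R) := Real.exp_le_exp.2 hw
      _ = R := Real.exp_log hRp
  have hd : ∀ w : ℂ, w.re ≤ Real.log R → DifferentiableAt ℂ (fun w => g (Complex.exp w)) w := by
    intro w hw
    exact (hg _ (hnorm w hw)).comp w Complex.differentiable_exp.differentiableAt
  have key := Complex.HadamardThreeLines.norm_le_interp_of_mem_verticalClosedStrip'
    (f := fun w => g (Complex.exp w)) (z := Complex.log t) (a := a) (b := b) hlog ?_ ?_ ?_ ?_ ?_
  · simpa [Complex.exp_log ht0, Complex.log_re] using key
  · simp only [Complex.HadamardThreeLines.verticalClosedStrip, mem_preimage, Complex.log_re, mem_Icc]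
    exact ⟨Real.log_le_log hε h1, Real.log_le_log htp h2⟩
  · apply DifferentiableOn.diffContOnCl
    intro w hw
    apply (hd w _).differentiableWithinAt
    have : closure (Complex.HadamardThreeLines.verticalStrip (Real.log ε) (Real.log R)) ⊆ {w : ℂ | w.re ≤ Real.log R} := by
      apply closure_minimal
      · intro w hw
        exact hw.2.le
      · exact isClosed_le Complex.continuous_re continuous_const
    exact this hw
  · refine ⟨b, ?_⟩
    rintro _ ⟨w, hw, rfl⟩
    exact hb _ (hnorm w hw.2)
  · intro w hw
    apply ha
    rw [Complex.norm_exp, show w.re = Real.log ε from hw, Real.exp_log hε]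
  · intro w hw
    apply hb
    exact hnorm w (le_of_eq hw)

/-- removable singularities + growth -/
lemma exists_entire (f : ℂ → ℂ) (Z : Set ℂ) (hZ : Z.Finite)
    (hf : ∀ t ∉ Z, DifferentiableAt ℂ f t) (C : ℝ) (S : ℕ) (hb : ∀ t, ‖f t‖ ≤ C * (1 + ‖t‖) ^ S) :
    ∃ h : ℂ → ℂ, Differentiable ℂ h ∧ (∀ t ∉ Z, h t = f t) ∧ ∀ t, ‖h t‖ ≤ C * (1 + ‖t‖) ^ S := by
  have hev : ∀ c, ∀ᶠ t in 𝓝[≠] c, t ∉ Z := fun c => by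
    have h1 : (Z \ {c}).Finite := hZ.subset sdiff_subset
    have h2 : (Z \ {c})ᶜ ∈ 𝓝 c := h1.isClosed.isOpen_compl.mem_nhds (by simp)
    rw [eventually_nhdsWithin_iff]
    filter_upwards [h2] with t ht htc hz
    exact ht ⟨hz, htc⟩
  set h : ℂ → ℂ := fun t => limUnder (𝓝[≠] t) f
  have heq : ∀ t ∉ Z, h t = f t := by
    intro t ht
    exact ((hf t ht).continuousAt.tendsto.mono_left nhdsWithin_le_nhds).limUnder_eq
  have hdiff : ∀ c, DifferentiableAt ℂ h c := by
    intro c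
    have hs := hev c
    rw [eventually_nhdsWithin_iff] at hs
    obtain ⟨η, hη, hs⟩ := Metric.eventually_nhds_iff_ball.1 hs
    have := Complex.differentiableOn_update_limUnder_of_bddAbove (f := f) (c := c) (s := ball c η)
      (ball_mem_nhds c hη) (fun t ht => (hf t (hs t ht.1 ht.2)).differentiableWithinAt)
      ⟨|C| * (1 + (‖c‖ + η)) ^ S, by
        rintro _ ⟨t, ht, rfl⟩
        refine (hb t).trans ?_
        have : ‖t‖ ≤ ‖c‖ + η := by
          have h1 := ht.1
          rw [mem_ball, dist_eq_norm] at h1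
          calc ‖t‖ = ‖c + (t - c)‖ := by simp
            _ ≤ ‖c‖ + ‖t-c‖ := norm_add_le _ _
            _ ≤ _ := by linarith
        have := le_abs_self C
        gcongr⟩
    have h1 := this.differentiableAt (ball_mem_nhds c hη)
    refine h1.congr_of_eventuallyEq ?_
    filter_upwards [ball_mem_nhds c hη] with t ht
    by_cases htc : t = c
    · subst htc; simp [h]
    · rw [Function.update_of_ne htc, heq t (hs t ht htc)]
  refine ⟨h, hdiff, heq, ?_⟩
  intro t
  have h1 : Tendsto (fun t => ‖h t‖) (𝓝[≠] t) (𝓝 ‖h t‖) :=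
    ((hdiff t).continuousAt.norm).tendsto.mono_left nhdsWithin_le_nhds
  have h2 : Tendsto (fun t : ℂ => C * (1 + ‖t‖) ^ S) (𝓝[≠] t) (𝓝 (C * (1 + ‖t‖) ^ S)) := by
    apply Tendsto.mono_left _ nhdsWithin_le_nhds
    apply Continuous.tendsto
    fun_prop
  refine le_of_tendsto_of_tendsto h1 h2 ?_
  filter_upwards [hev t] with s hs
  rw [heq s hs]; exact hb s

lemma iteratedDeriv_zero_of_growth (h : ℂ → ℂ) (hd : Differentiable ℂ h) (C : ℝ) (S n : ℕ)
    (hn : S < n) (hb : ∀ t, ‖h t‖ ≤ C * (1 + ‖t‖) ^ S) : iteratedDeriv n h 0 = 0 := by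
  have hC : 0 ≤ C := by simpa using (norm_nonneg _).trans (hb 0)
  have key : ∀ R : ℝ, 1 ≤ R → ‖iteratedDeriv n h 0‖ ≤ (n.factorial * C * 2 ^ S) * R⁻¹ := by
    intro R hR
    have hR0 : 0 < R := by linarith
    refine (Complex.norm_iteratedDeriv_le_of_forall_mem_sphere_norm_le (C := C * (2 * R) ^ S) n
      hR0 hd.diffContOnCl ?_).trans ?_
    · intro z hz
      refine (hb z).trans ?_
      have : ‖z‖ = R := by simpa using hz
      rw [this]
      gcongr; linarith
    · rw [mul_pow, div_eq_mul_inv, ← mul_assoc, ← mul_assoc, mul_assoc (_ * _) (R^S)]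
      gcongr
      rw [← div_eq_mul_inv, div_le_iff₀ (by positivity), inv_mul_eq_div, le_div_iff₀ hR0, ← pow_succ]
      exact pow_le_pow_right₀ hR hn
  have : Tendsto (fun R : ℝ => (n.factorial * C * 2 ^ S) * R⁻¹) atTop (𝓝 ((n.factorial * C * 2 ^ S) * 0)) :=
    tendsto_inv_atTop_zero.const_mul _
  rw [mul_zero] at this
  have h2 := ge_of_tendsto this (by filter_upwards [eventually_ge_atTop 1] with R hR using key R hR)
  exact norm_le_zero_iff.1 h2

lemma multilinear_poly {k n : ℕ} (q : ContinuousMultilinearMap ℂ (fun _ : Fin n => (Fin k → ℂ)) ℂ) :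
    ∃ p : MvPolynomial (Fin k) ℂ, ∀ y, eval y p = q (fun _ => y) := by
  classical
  refine ⟨∑ r : Fin n → Fin k, C (q (fun i => Pi.single (r i) 1)) * ∏ i, X (r i), fun y => ?_⟩
  have hy : y = ∑ j, y j • (Pi.single j (1:ℂ) : Fin k → ℂ) := by
    ext i; simp [Finset.sum_apply, Pi.single_apply]
  conv_rhs => rw [hy]
  rw [ContinuousMultilinearMap.map_sum]
  simp only [map_sum, map_mul, map_prod, eval_C, eval_X]
  refine Finset.sum_congr rfl fun r _ => ?_
  rw [ContinuousMultilinearMap.map_smul_univ, smul_eq_mul, mul_comm]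

lemma poly_of_lines {k : ℕ} (g : (Fin k → ℂ) → ℂ) (x0 : Fin k → ℂ) (hg : AnalyticAt ℂ g x0) (S : ℕ)
    (hline : ∀ v : Fin k → ℂ, ∃ h : ℂ → ℂ, Differentiable ℂ h ∧
      (∀ᶠ t in 𝓝 (0:ℂ), h t = g (x0 + t • v)) ∧ ∃ C, ∀ t, ‖h t‖ ≤ C * (1 + ‖t‖) ^ S) :
    ∃ p : MvPolynomial (Fin k) ℂ, ∀ᶠ x in 𝓝 x0, eval x p = g x := by
  obtain ⟨q, hq⟩ := hg
  have hzero : ∀ n, S < n → ∀ v, q n (fun _ => v) = 0 := by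
    intro n hn v
    obtain ⟨h, hd, he, C, hC⟩ := hline v
    have h0 := iteratedDeriv_zero_of_growth h hd C S n hn hC
    set u : ℂ →L[ℂ] (Fin k → ℂ) := (ContinuousLinearMap.id ℂ ℂ).smulRight v
    have h1 : HasFPowerSeriesAt (fun y => g (x0 + y)) q 0 := by
      have := hq.comp_sub (-x0)
      simpa [add_comm] using this
    have h2 : HasFPowerSeriesAt ((fun y => g (x0 + y)) ∘ u) (q.compContinuousLinearMap u) 0 := by
      apply HasFPowerSeriesAt.compContinuousLinearMap
      simpa using h1
    have h3 : HasFPowerSeriesAt h (q.compContinuousLinearMap u) 0 := by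
      refine h2.congr ?_
      filter_upwards [he] with t ht
      rw [ht]; simp [u]
    obtain ⟨r, h4⟩ := h3
    have h5 := h4.factorial_smul (1:ℂ) n
    rw [iteratedDeriv_eq_iteratedFDeriv] at h0
    rw [h0] at h5
    have h6 : (n.factorial : ℂ) ≠ 0 := by exact_mod_cast n.factorial_ne_zero
    have h7 : q n (fun _ => v) = (q.compContinuousLinearMap u) n (fun _ => 1) := by
      rw [FormalMultilinearSeries.compContinuousLinearMap_apply]
      congr 1
      ext i j
      simp [u]
    rw [h7]
    simpa [n.factorial_ne_zero] using h5
  choose p hp using fun n => multilinear_poly (q n)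
  refine ⟨aeval (fun i => X i - C (x0 i)) (∑ n ∈ Finset.range (S+1), p n), ?_⟩
  obtain ⟨r, hr⟩ := hq
  filter_upwards [Metric.eball_mem_nhds x0 hr.r_pos] with x hx
  have hx' : x - x0 ∈ Metric.eball (0 : Fin k → ℂ) r := by
    simpa [edist_eq_enorm_sub] using hx
  have h1 := hr.hasSum hx'
  have h2 := h1.unique (hasSum_sum_of_ne_finset_zero (s := Finset.range (S+1)) (fun n hn =>
    hzero n (by simpa [Nat.succ_le_iff] using hn) _))
  rw [add_sub_cancel] at h2
  rw [h2, ← coe_aeval_eq_eval]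
  simp only [RingHom.coe_coe]
  rw [MvPolynomial.comp_aeval_apply, map_sum]
  refine Finset.sum_congr rfl fun n _ => ?_
  rw [← hp n, ← coe_aeval_eq_eval]
  simp only [RingHom.coe_coe]
  congr 2
  ext i
  simp

end BW
end

section
open scoped Topology
namespace BW

variable {k : ℕ}

lemma analyticAt_eval (p : MvPolynomial (Fin k) ℂ) (x : Fin k → ℂ) :
    AnalyticAt ℂ (fun x => eval x p) x :=
  AnalyticOnNhd.eval_mvPolynomial p x (mem_univ x)

lemma continuous_eval' (p : MvPolynomial (Fin k) ℂ) : Continuous (fun x => eval x p) :=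
  continuous_iff_continuousAt.2 fun x => (analyticAt_eval p x).continuousAt

lemma eval_bounded (p : MvPolynomial (Fin k) ℂ) (R : ℝ) :
    ∃ C : ℝ, 0 ≤ C ∧ ∀ x, ‖x‖ ≤ R → ‖eval x p‖ ≤ C := by
  obtain ⟨C, hC⟩ := (isCompact_closedBall (0 : Fin k → ℂ) R).exists_bound_of_continuousOn
    (continuous_eval' p).continuousOn
  exact ⟨|C|, abs_nonneg _, fun x hx => (hC x (by simpa using hx)).trans (le_abs_self _)⟩

lemma eval_line_growth (p : MvPolynomial (Fin k) ℂ) (x0 v : Fin k → ℂ) :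
    ∃ C : ℝ, 0 ≤ C ∧ ∀ t : ℂ, ‖eval (x0 + t • v) p‖ ≤ C * (1 + ‖t‖) ^ p.totalDegree := by
  obtain ⟨g, hg, hg'⟩ := line_poly p x0 v
  refine ⟨∑ i ∈ Finset.range (p.totalDegree+1), ‖g.coeff i‖, by positivity, fun t => ?_⟩
  rw [← hg', Polynomial.eval_eq_sum_range' (Nat.lt_succ_of_le hg), Finset.sum_mul]
  refine (norm_sum_le _ _).trans (Finset.sum_le_sum fun i hi => ?_)
  rw [norm_mul, norm_pow]
  have hile : i ≤ p.totalDegree := by simpa [Nat.lt_succ_iff] using hi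
  gcongr
  calc ‖t‖ ^ i ≤ (1 + ‖t‖) ^ i := by gcongr; linarith
    _ ≤ _ := pow_le_pow_right₀ (by linarith [norm_nonneg t]) hile

/-- value of the specialised polynomial. -/
lemma eval_spec (P : Polynomial (MvPolynomial (Fin k) ℂ)) (x : Fin k → ℂ) (τ : ℂ) :
    (P.map (eval x)).eval τ = ∑ i ∈ Finset.range (P.natDegree + 1), eval x (P.coeff i) * τ ^ i := by
  rw [Polynomial.eval_eq_sum_range' (Nat.lt_succ_of_le Polynomial.natDegree_map_le)]
  simp

lemma root_bound (P : Polynomial (MvPolynomial (Fin k) ℂ)) (hP : P.Monic) (x : Fin k → ℂ) (τ : ℂ)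
    (h : (P.map (eval x)).eval τ = 0) :
    ‖τ‖ ≤ 1 + ∑ i ∈ Finset.range P.natDegree, ‖eval x (P.coeff i)‖ := by
  have hs : 0 ≤ ∑ i ∈ Finset.range P.natDegree, ‖eval x (P.coeff i)‖ := by positivity
  rcases le_or_gt ‖τ‖ 1 with h1 | h1
  · linarith
  rw [eval_spec, Finset.sum_range_succ] at h
  have hc : P.coeff P.natDegree = 1 := hP
  rw [hc, map_one, one_mul] at h
  have h2 : ‖τ‖ ^ P.natDegree ≤ ∑ i ∈ Finset.range P.natDegree, ‖eval x (P.coeff i)‖ * ‖τ‖ ^ i := by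
    rw [← norm_pow, eq_neg_of_add_eq_zero_right h, norm_neg]
    refine (norm_sum_le _ _).trans (le_of_eq ?_)
    simp
  have h3 : ∑ i ∈ Finset.range P.natDegree, ‖eval x (P.coeff i)‖ * ‖τ‖ ^ i * ‖τ‖ ≤
      (∑ i ∈ Finset.range P.natDegree, ‖eval x (P.coeff i)‖) * ‖τ‖ ^ P.natDegree := by
    rw [Finset.sum_mul]
    refine Finset.sum_le_sum fun i hi => ?_
    rw [mul_assoc, ← pow_succ]
    have : i + 1 ≤ P.natDegree := by simpa using hi
    gcongr
    exact h1.le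
  have h4 : ‖τ‖ ^ P.natDegree * ‖τ‖ ≤
      (∑ i ∈ Finset.range P.natDegree, ‖eval x (P.coeff i)‖) * ‖τ‖ ^ P.natDegree := by
    refine le_trans ?_ h3
    rw [← Finset.sum_mul]
    gcongr
  have h5 : 0 < ‖τ‖ ^ P.natDegree := by positivity
  have : ‖τ‖ ≤ ∑ i ∈ Finset.range P.natDegree, ‖eval x (P.coeff i)‖ := by
    rw [mul_comm] at h4
    exact le_of_mul_le_mul_right h4 h5
  linarith

lemma root_bound_ball (P : Polynomial (MvPolynomial (Fin k) ℂ)) (hP : P.Monic) (R : ℝ) :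
    ∃ T : ℝ, 1 ≤ T ∧ ∀ x, ‖x‖ ≤ R → ∀ τ, (P.map (eval x)).eval τ = 0 → ‖τ‖ ≤ T := by
  choose C hC0 hC using fun p : MvPolynomial (Fin k) ℂ => eval_bounded p R
  refine ⟨1 + ∑ i ∈ Finset.range P.natDegree, C (P.coeff i), ?_, ?_⟩
  · have : 0 ≤ ∑ i ∈ Finset.range P.natDegree, C (P.coeff i) := Finset.sum_nonneg fun i _ => hC0 _
    linarith
  · intro x hx τ h
    refine (root_bound P hP x τ h).trans ?_
    gcongr with i hi
    exact hC _ x hx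

lemma analytic_spec (P : Polynomial (MvPolynomial (Fin k) ℂ)) (y : (Fin k → ℂ) × ℂ) :
    AnalyticAt ℂ (fun y : (Fin k → ℂ) × ℂ => (P.map (eval y.1)).eval y.2) y := by
  simp only [eval_spec]
  refine Finset.analyticAt_fun_sum _ fun i _ => ?_
  refine AnalyticAt.mul ?_ (analyticAt_snd.pow i)
  exact (analyticAt_eval (P.coeff i) y.1).comp analyticAt_fst

lemma implicit_root (P : Polynomial (MvPolynomial (Fin k) ℂ)) (x1 : Fin k → ℂ) (τ : ℂ)
    (h : (P.map (eval x1)).eval τ = 0) (hd : (P.map (eval x1)).derivative.eval τ ≠ 0) :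
    ∃ φ : (Fin k → ℂ) → ℂ, AnalyticAt ℂ φ x1 ∧ φ x1 = τ ∧
      ∀ᶠ x in 𝓝 x1, (P.map (eval x)).eval (φ x) = 0 := by
  set f : (Fin k → ℂ) × ℂ → ℂ := fun y => (P.map (eval y.1)).eval y.2 with hf
  have hcd : ContDiffAt ℂ ⊤ f (x1, τ) := (analytic_spec P (x1, τ)).contDiffAt
  have hinv : (fderiv ℂ f (x1, τ) ∘L .inr ℂ (Fin k → ℂ) ℂ).IsInvertible := by
    have h1 : HasFDerivAt f (fderiv ℂ f (x1, τ)) (x1, τ) :=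
      (analytic_spec P (x1, τ)).differentiableAt.hasFDerivAt
    have h2 : HasFDerivAt (fun t : ℂ => f (x1, t)) (fderiv ℂ f (x1, τ) ∘L .inr ℂ (Fin k → ℂ) ℂ) τ :=
      HasFDerivAt.comp τ h1 (hasFDerivAt_prodMk_right x1 τ)
    have h3 := h2.unique ((P.map (eval x1)).hasDerivAt τ).hasFDerivAt
    rw [h3]
    refine ⟨ContinuousLinearEquiv.unitsEquivAut ℂ (Units.mk0 _ hd), ?_⟩
    ext
    simp
  refine ⟨hcd.implicitFunction (by simp) hinv, ?_, ?_, ?_⟩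
  · have := hcd.contDiffAt_implicitFunction (by simp) hinv
    exact this.analyticAt
  · exact hcd.implicitFunction_apply_self (by simp) hinv
  · have := hcd.eventually_apply_implicitFunction (by simp) hinv
    filter_upwards [this] with x hx
    simpa [hf, h] using hx

lemma sheets (P : Polynomial (MvPolynomial (Fin k) ℂ)) (hP : P.Monic) (x1 : Fin k → ℂ)
    (hsep : (P.map (eval x1)).Separable) :
    ∃ ρ : ℝ, 0 < ρ ∧ ∃ φ : Fin P.natDegree → (Fin k → ℂ) → ℂ,
      (∀ i, ∀ x ∈ ball x1 ρ, AnalyticAt ℂ (φ i) x) ∧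
      (∀ x ∈ ball x1 ρ, Function.Injective fun i => φ i x) ∧
      (∀ x ∈ ball x1 ρ, P.map (eval x) = ∏ i, (Polynomial.X - Polynomial.C (φ i x))) := by
  classical
  have hPm : (P.map (eval x1)).Monic := hP.map _
  have hdeg : ∀ x, (P.map (eval x)).natDegree = P.natDegree := fun x => hP.natDegree_map _
  have hcard : (P.map (eval x1)).roots.toFinset.card = P.natDegree := by
    rw [Multiset.toFinset_card_of_nodup (Polynomial.nodup_roots hsep), ← hdeg x1]
    exact (IsAlgClosed.splits _).natDegree_eq_card_roots.symm
  let e := (Finset.equivFinOfCardEq hcard).symm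
  have hroot : ∀ i, (P.map (eval x1)).eval (e i : ℂ) = 0 := fun i => by
    have := (e i).2
    rw [Multiset.mem_toFinset, Polynomial.mem_roots hPm.ne_zero] at this
    exact this
  choose φ hφa hφ1 hφr using fun i => implicit_root P x1 (e i) (hroot i)
    (by
      obtain ⟨a, b, hab⟩ := hsep
      intro h0
      have := congrArg (Polynomial.eval (e i : ℂ)) hab
      rw [Polynomial.eval_add, Polynomial.eval_mul, Polynomial.eval_mul, hroot i, h0] at this
      simp at this)
  have hev : ∀ᶠ x in 𝓝 x1, (∀ i, AnalyticAt ℂ (φ i) x) ∧ (∀ i, (P.map (eval x)).eval (φ i x) = 0) ∧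
      ∀ i j, i ≠ j → φ i x ≠ φ j x := by
    simp only [eventually_and, eventually_all]
    refine ⟨fun i => (hφa i).eventually_analyticAt, hφr, fun i j hij => ?_⟩
    have h1 := ((hφa i).continuousAt.sub (hφa j).continuousAt).eventually_ne (y := 0) (by
      simp only [Pi.sub_apply, hφ1]
      exact sub_ne_zero.2 fun h => hij (e.injective (Subtype.ext h)))
    filter_upwards [h1] with x hx
    exact sub_ne_zero.1 hx
  obtain ⟨ρ, hρ, h⟩ := Metric.eventually_nhds_iff_ball.1 hev
  have hinj : ∀ x ∈ ball x1 ρ, Function.Injective fun i => φ i x := fun x hx i j hij => by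
    by_contra hne
    exact (h x hx).2.2 i j hne hij
  refine ⟨ρ, hρ, φ, fun i x hx => (h x hx).1 i, hinj, fun x hx => ?_⟩
  have hd : ∏ i, (Polynomial.X - Polynomial.C (φ i x)) ∣ P.map (eval x) := by
    apply Finset.prod_dvd_of_coprime
    · intro i _ j _ hij
      exact Polynomial.isCoprime_X_sub_C_of_isUnit_sub
        (sub_ne_zero.2 ((h x hx).2.2 i j hij)).isUnit
    · intro i _
      rw [Polynomial.dvd_iff_isRoot]
      exact (h x hx).2.1 i
  have hm : (∏ i, (Polynomial.X - Polynomial.C (φ i x))).Monic :=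
    Polynomial.monic_prod_of_monic _ _ fun i _ => Polynomial.monic_X_sub_C _
  refine (Polynomial.eq_of_monic_of_dvd_of_natDegree_le hm (hP.map _) hd ?_)
  rw [hdeg, Polynomial.natDegree_prod_of_monic _ _ fun i _ => Polynomial.monic_X_sub_C _]
  simp

/-- the value of `∑ c_j τ^j` at `(x, τ)`. -/
noncomputable def Fval {m : ℕ} (c : Fin m → MvPolynomial (Fin k) ℂ) (x : Fin k → ℂ) (τ : ℂ) : ℂ :=
  ∑ j, eval x (c j) * τ ^ (j : ℕ)

lemma vandermonde_bound {m : ℕ} (x0 : Fin k → ℂ) (ρ : ℝ) (hρ : 0 < ρ)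
    (φ : Fin m → (Fin k → ℂ) → ℂ) (ha : ∀ i, ∀ x ∈ ball x0 ρ, AnalyticAt ℂ (φ i) x)
    (hinj : ∀ x ∈ ball x0 ρ, Function.Injective fun i => φ i x) :
    ∃ K : ℝ, 0 ≤ K ∧ ∀ x ∈ ball x0 (ρ/2), ∀ c : Fin m → ℂ, ∀ B : ℝ,
      (∀ i, ‖∑ j, c j * φ i x ^ (j:ℕ)‖ ≤ B) → ∀ j, ‖c j‖ ≤ K * B := by
  let V : (Fin k → ℂ) → Matrix (Fin m) (Fin m) ℂ := fun x => Matrix.vandermonde fun i => φ i x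
  have hsub : closedBall x0 (ρ/2) ⊆ ball x0 ρ := closedBall_subset_ball (by linarith)
  have hVc : ContinuousOn V (closedBall x0 (ρ/2)) := by
    refine continuousOn_pi.2 fun i => continuousOn_pi.2 fun j => ?_
    simp only [V, Matrix.vandermonde_apply]
    exact ContinuousOn.pow (fun x hx => (ha i x (hsub hx)).continuousAt.continuousWithinAt) _
  have hdet : ∀ x ∈ ball x0 ρ, (V x).det ≠ 0 := fun x hx => Matrix.det_vandermonde_ne_zero_iff.2 (hinj x hx)
  have hW : ContinuousOn (fun x => (V x).det⁻¹ • (V x).adjugate) (closedBall x0 (ρ/2)) := by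
    apply ContinuousOn.fun_smul
    · exact ContinuousOn.inv₀ ((Continuous.matrix_det continuous_id).comp_continuousOn hVc) (fun x hx => hdet x (hsub hx))
    · exact (Continuous.matrix_adjugate continuous_id).comp_continuousOn hVc
  have hent : ∀ i j, ∃ C, ∀ x ∈ closedBall x0 (ρ/2), ‖((V x).det⁻¹ • (V x).adjugate) i j‖ ≤ C := by
    intro i j
    apply (isCompact_closedBall x0 (ρ/2)).exists_bound_of_continuousOn
    exact continuousOn_pi.1 (continuousOn_pi.1 hW i) j
  choose C hC using hent
  refine ⟨∑ i, ∑ j, |C i j|, by positivity, ?_⟩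
  intro x hx c B hB j
  have hx' := ball_subset_closedBall hx
  have hB0 : 0 ≤ B := (norm_nonneg _).trans (hB j)
  have h1 : c = ((V x).det⁻¹ • (V x).adjugate).mulVec ((V x).mulVec c) := by
    rw [Matrix.mulVec_mulVec, Matrix.smul_mul, Matrix.adjugate_mul, smul_smul,
      inv_mul_cancel₀ (hdet x (hsub hx')), one_smul, Matrix.one_mulVec]
  have h2 : ∀ i, ‖((V x).mulVec c) i‖ ≤ B := by
    intro i
    refine le_trans (le_of_eq ?_) (hB i)
    congr 1
    simp only [Matrix.mulVec, dotProduct, V, Matrix.vandermonde_apply]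
    exact Finset.sum_congr rfl fun j _ => mul_comm _ _
  rw [h1]
  calc _ ≤ ∑ i, ‖((V x).det⁻¹ • (V x).adjugate) j i * ((V x).mulVec c) i‖ := norm_sum_le _ _
    _ ≤ ∑ i, |C j i| * B := by
        refine Finset.sum_le_sum fun i _ => ?_
        rw [norm_mul]
        gcongr
        · exact (hC j i x hx').trans (le_abs_self _)
        · exact h2 i
    _ = (∑ i, |C j i|) * B := by rw [Finset.sum_mul]
    _ ≤ _ := by
        refine mul_le_mul_of_nonneg_right ?_ hB0
        exact Finset.single_le_sum (f := fun j => ∑ i, |C j i|) (fun i _ => by positivity) (Finset.mem_univ j)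

lemma global_bound (P : Polynomial (MvPolynomial (Fin k) ℂ)) (hP : P.Monic) (x0 : Fin k → ℂ)
    (hsep : (P.map (eval x0)).Separable) (ρ R : ℝ) (hρ : 0 < ρ) :
    ∃ C : ℝ, 1 ≤ C ∧ ∀ n : ℕ, 1 ≤ n → ∀ c : Fin P.natDegree → MvPolynomial (Fin k) ℂ,
      (∀ j, (c j).totalDegree ≤ n) → ∀ M : ℝ, 0 ≤ M →
      (∀ x ∈ ball x0 ρ, ∀ τ, (P.map (eval x)).eval τ = 0 → ‖Fval c x τ‖ ≤ M) →
      ∀ x, ‖x‖ ≤ R → ∀ τ, (P.map (eval x)).eval τ = 0 → ‖Fval c x τ‖ ≤ C ^ n * M := by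
  obtain ⟨ρ1, hρ1, φ, ha, hinj, hprod⟩ := sheets P hP x0 hsep
  set ρ2 := min ρ ρ1 with hρ2
  have hρpos : 0 < ρ2 := lt_min hρ hρ1
  have hs1 : ball x0 ρ2 ⊆ ball x0 ρ1 := ball_subset_ball (min_le_right _ _)
  have hs : ball x0 (ρ2/2) ⊆ ball x0 ρ := ball_subset_ball (by have := min_le_left ρ ρ1; linarith)
  have hs' : ball x0 (ρ2/2) ⊆ ball x0 ρ1 := (ball_subset_ball (by linarith)).trans hs1
  obtain ⟨K, hK0, hK⟩ := vandermonde_bound x0 ρ2 hρpos φ (fun i x hx => ha i x (hs1 hx))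
    (fun x hx => hinj x (hs1 hx))
  obtain ⟨C1, hC1, hbw⟩ := bw_multi x0 (ρ2/2) R (by positivity)
  obtain ⟨T, hT1, hT⟩ := root_bound_ball P hP R
  refine ⟨C1 * max 1 (P.natDegree * K * T ^ P.natDegree), ?_, ?_⟩
  · exact one_le_mul_of_one_le_of_one_le hC1 (le_max_left _ _)
  intro n hn c hc M hM hF x hx τ hτ
  have hcj : ∀ j, ‖eval x (c j)‖ ≤ C1 ^ n * (K * M) := by
    intro j
    refine hbw n (c j) (hc j) (K * M) (fun y hy => ?_) x hx
    refine hK y hy (fun j => eval y (c j)) M (fun i => ?_) j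
    refine hF y (hs hy) (φ i y) ?_
    rw [hprod y (hs' hy), Polynomial.eval_prod]
    exact Finset.prod_eq_zero (Finset.mem_univ i) (by simp)
  have hτT := hT x hx τ hτ
  calc ‖Fval c x τ‖ ≤ ∑ j, ‖eval x (c j) * τ ^ (j:ℕ)‖ := norm_sum_le _ _
    _ ≤ ∑ j : Fin P.natDegree, C1 ^ n * (K * M) * T ^ P.natDegree := by
        refine Finset.sum_le_sum fun j _ => ?_
        rw [norm_mul, norm_pow]
        gcongr
        · exact hcj j
        · calc ‖τ‖ ^ (j:ℕ) ≤ T ^ (j:ℕ) := by gcongr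
            _ ≤ T ^ P.natDegree := pow_le_pow_right₀ hT1 j.2.le
    _ = C1 ^ n * (P.natDegree * K * T ^ P.natDegree) * M := by simp; ring
    _ ≤ C1 ^ n * (max 1 (P.natDegree * K * T ^ P.natDegree)) ^ n * M := by
        gcongr
        calc _ ≤ max 1 (P.natDegree * K * T ^ P.natDegree) := le_max_right _ _
          _ ≤ _ := le_self_pow₀ (le_max_left _ _) (by omega)
    _ = _ := by rw [mul_pow]

end BW
end

section
open scoped Topology
namespace BW

variable {k : ℕ}

/-- The test polynomials `∑ c_j T^j` of degree at most `n`, bounded by one near `(x0, τ0)` and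
bounded by `M` over the unit ball around `x0`. -/
structure Test (P : Polynomial (MvPolynomial (Fin k) ℂ)) (x0 : Fin k → ℂ) (τ0 : ℂ) (r : ℝ)
    (n : ℕ) (c : Fin P.natDegree → MvPolynomial (Fin k) ℂ) (M : ℝ) : Prop where
  one_le : 1 ≤ n
  deg : ∀ j, (c j).totalDegree ≤ n
  M_one : 1 ≤ M
  small : ∀ x ∈ ball x0 r, ∀ τ ∈ ball τ0 r, (P.map (eval x)).eval τ = 0 → ‖Fval c x τ‖ ≤ 1
  bdd : ∀ x ∈ ball x0 1, ∀ τ, (P.map (eval x)).eval τ = 0 → ‖Fval c x τ‖ ≤ M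

/-- A good point of the hypersurface. -/
def Good (P : Polynomial (MvPolynomial (Fin k) ℂ)) (Δ : MvPolynomial (Fin k) ℂ)
    (x0 : Fin k → ℂ) (τ0 : ℂ) (r : ℝ) (x1 : Fin k → ℂ) (τ1 : ℂ) : Prop :=
  eval x1 Δ ≠ 0 ∧ (P.map (eval x1)).eval τ1 = 0 ∧ ∃ ε : ℝ, 0 < ε ∧ ∃ C : ℝ, 1 ≤ C ∧ ∃ α : ℝ, 0 < α ∧
    α ≤ 1 ∧ ∀ n c M, Test P x0 τ0 r n c M → ∀ x ∈ ball x1 ε, ∀ τ ∈ ball τ1 ε,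
      (P.map (eval x)).eval τ = 0 → ‖Fval c x τ‖ ≤ C ^ n * M ^ (1 - α)

lemma analyticAt_Fval {m : ℕ} (c : Fin m → MvPolynomial (Fin k) ℂ) (φ : (Fin k → ℂ) → ℂ)
    (x : Fin k → ℂ) (h : AnalyticAt ℂ φ x) : AnalyticAt ℂ (fun y => Fval c y (φ y)) x := by
  unfold Fval
  exact Finset.analyticAt_fun_sum _ fun j _ => (analyticAt_eval _ _).mul (h.pow _)

lemma good_base (P : Polynomial (MvPolynomial (Fin k) ℂ)) (Δ : MvPolynomial (Fin k) ℂ)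
    (x0 : Fin k → ℂ) (τ0 : ℂ) (r : ℝ) (hr : 0 < r) (h1 : eval x0 Δ ≠ 0)
    (h2 : (P.map (eval x0)).eval τ0 = 0) : Good P Δ x0 τ0 r x0 τ0 := by
  refine ⟨h1, h2, r, hr, 1, le_rfl, 1, one_pos, le_rfl, ?_⟩
  intro n c M hT x hx τ hτ h
  simpa using hT.small x hx τ hτ h

lemma good_spread (P : Polynomial (MvPolynomial (Fin k) ℂ)) (hP : P.Monic) (Δ : MvPolynomial (Fin k) ℂ)
    (x0 : Fin k → ℂ) (τ0 : ℂ) (r : ℝ) (hsep0 : (P.map (eval x0)).Separable)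
    (x1 : Fin k → ℂ) (ρ : ℝ) (hρ : 0 < ρ) (φ : Fin P.natDegree → (Fin k → ℂ) → ℂ)
    (ha : ∀ i, ∀ x ∈ ball x1 ρ, AnalyticAt ℂ (φ i) x)
    (hinj : ∀ x ∈ ball x1 ρ, Function.Injective fun i => φ i x)
    (hprod : ∀ x ∈ ball x1 ρ, P.map (eval x) = ∏ i, (Polynomial.X - Polynomial.C (φ i x)))
    (hΔ : ∀ x ∈ ball x1 ρ, eval x Δ ≠ 0)
    (i : Fin P.natDegree) (x' x : Fin k → ℂ) (hx' : x' ∈ ball x1 (ρ / 4)) (hx : x ∈ ball x1 (ρ / 4))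
    (hg : Good P Δ x0 τ0 r x' (φ i x')) : Good P Δ x0 τ0 r x (φ i x) := by
  have hroot : ∀ y ∈ ball x1 ρ, ∀ j, (P.map (eval y)).eval (φ j y) = 0 := by
    intro y hy j
    rw [hprod y hy, Polynomial.eval_prod]
    exact Finset.prod_eq_zero (Finset.mem_univ j) (by simp)
  have hroot' : ∀ y ∈ ball x1 ρ, ∀ τ, (P.map (eval y)).eval τ = 0 → ∃ j, τ = φ j y := by
    intro y hy τ h
    rw [hprod y hy, Polynomial.eval_prod, Finset.prod_eq_zero_iff] at h
    obtain ⟨j, -, h⟩ := h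
    exact ⟨j, by simpa [sub_eq_zero] using h⟩
  have hxρ : x ∈ ball x1 ρ := ball_subset_ball (by linarith) hx
  have hxρ' : x' ∈ ball x1 ρ := ball_subset_ball (by linarith) hx'
  obtain ⟨-, -, ε, hε, C, hC, α, hα, hα1, hgood⟩ := hg
  obtain ⟨C2, hC2, hglob⟩ := global_bound P hP x0 hsep0 1 (‖x1‖ + ρ) one_pos
  set C3 := max C C2
  have hC3 : 1 ≤ C3 := hC.trans (le_max_left _ _)
  -- small radius
  obtain ⟨ε1, hε1, hcont⟩ := Metric.continuousAt_iff.1 (ha i x' hxρ').continuousAt ε hε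
  obtain ⟨ε2, hε2, h21, h22, h23⟩ : ∃ ε2 : ℝ, 0 < ε2 ∧ ε2 < ε1 ∧ ε2 < ε ∧ ε2 < ρ / 4 := by
    refine ⟨min ε1 (min ε (ρ/4)) / 2, by positivity, ?_, ?_, ?_⟩
    · have : min ε1 (min ε (ρ/4)) ≤ ε1 := min_le_left _ _
      linarith
    · have : min ε1 (min ε (ρ/4)) ≤ ε := (min_le_right _ _).trans (min_le_left _ _)
      linarith
    · have : min ε1 (min ε (ρ/4)) ≤ ρ/4 := (min_le_right _ _).trans (min_le_right _ _)
      linarith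
  set s0 := (Real.log (ρ * (6/10)) - Real.log ε2) / (Real.log (ρ * (7/10)) - Real.log ε2) with hs0
  have hlog1 : Real.log ε2 < Real.log (ρ * (6/10)) := Real.log_lt_log hε2 (by linarith)
  have hlog2 : Real.log (ρ * (6/10)) < Real.log (ρ * (7/10)) := Real.log_lt_log (by positivity) (by linarith)
  have hs0p : 0 ≤ s0 := div_nonneg (by linarith) (by linarith)
  have hs01 : s0 < 1 := by rw [hs0, div_lt_one (by linarith)]; linarith
  have hα' : 0 < α * (1 - s0) := mul_pos hα (by linarith)
  have hαle : α * (1 - s0) ≤ α := by nlinarith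
  -- separation of sheets
  have hsepa : ∀ᶠ y : (Fin k → ℂ) × ℂ in 𝓝 (x, φ i x), ∀ j, j ≠ i → y.2 ≠ φ j y.1 := by
    rw [eventually_all]
    intro j
    by_cases hij : j = i
    · simp [hij]
    · have h1 : ContinuousAt (fun y : (Fin k → ℂ) × ℂ => y.2 - φ j y.1) (x, φ i x) := by
        refine continuousAt_snd.sub ?_
        exact ContinuousAt.comp (f := Prod.fst) (g := φ j) (ha j x hxρ).continuousAt continuousAt_fst
      have h2 := h1.eventually_ne (y := 0) (sub_ne_zero.2 fun h => hij (hinj x hxρ h.symm))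
      filter_upwards [h2] with y hy _
      exact sub_ne_zero.1 hy
  obtain ⟨ε3, hε3, hsepa⟩ := Metric.eventually_nhds_iff_ball.1 hsepa
  refine ⟨hΔ x hxρ, hroot x hxρ i, min ε3 (ρ/10), by positivity, C3, hC3, α * (1 - s0), hα', by linarith, ?_⟩
  intro n c M hT y hy τ hτ hyτ
  have hM0 : 0 < M := by linarith [hT.M_one]
  have hyx : ‖y - x‖ < ρ / 10 := by
    have := mem_ball.1 (ball_subset_ball (min_le_right _ _) hy)
    rwa [dist_eq_norm] at this
  have hx1 : ‖x - x1‖ < ρ/4 := by rwa [mem_ball, dist_eq_norm] at hx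
  have hx1' : ‖x' - x1‖ < ρ/4 := by rwa [mem_ball, dist_eq_norm] at hx'
  have hyx' : ‖y - x'‖ ≤ ρ * (6/10) := by
    have : y - x' = (y - x) + ((x - x1) - (x' - x1)) := by abel
    rw [this]
    have h1 := norm_add_le (y - x) ((x - x1) - (x' - x1))
    have h2 := norm_sub_le (x - x1) (x' - x1)
    linarith
  have hin : ∀ w, ‖w - x'‖ ≤ ρ * (7/10) → w ∈ ball x1 ρ := by
    intro w hw
    rw [mem_ball, dist_eq_norm]
    have : w - x1 = (w - x') + (x' - x1) := by abel
    rw [this]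
    have h1 := norm_add_le (w - x') (x' - x1)
    linarith
  have hyρ : y ∈ ball x1 ρ := hin y (by linarith)
  have hτeq : τ = φ i y := by
    obtain ⟨j, hj⟩ := hroot' y hyρ τ hyτ
    by_cases hij : j = i
    · rw [hj, hij]
    · refine absurd hj (hsepa (y, τ) ?_ j hij)
      rw [← ball_prod_same]
      exact ⟨ball_subset_ball (min_le_left _ _) hy, ball_subset_ball (min_le_left _ _) hτ⟩
  rw [hτeq]
  have hpow : M ^ (1 - α) ≤ M ^ (1 - α * (1 - s0)) :=
    Real.rpow_le_rpow_of_exponent_le hT.M_one (by linarith)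
  -- bounds
  have hsmall : ∀ w, ‖w - x'‖ ≤ ε2 → ‖Fval c w (φ i w)‖ ≤ C3 ^ n * M ^ (1 - α) := by
    intro w hw
    have hw1 : w ∈ ball x1 ρ := hin w (by linarith)
    have h1 := hgood n c M hT w (by rw [mem_ball, dist_eq_norm]; linarith) (φ i w)
      (hcont (by rw [dist_eq_norm]; linarith)) (hroot w hw1 i)
    refine h1.trans ?_
    gcongr
    exact le_max_left _ _
  have hbig : ∀ w, ‖w - x'‖ ≤ ρ * (7/10) → ‖Fval c w (φ i w)‖ ≤ C3 ^ n * M := by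
    intro w hw
    have hw1 : w ∈ ball x1 ρ := hin w hw
    have h1 := hglob n hT.one_le c hT.deg M hM0.le hT.bdd w (by
      rw [mem_ball, dist_eq_norm] at hw1
      calc ‖w‖ = ‖x1 + (w - x1)‖ := by simp
        _ ≤ ‖x1‖ + ‖w - x1‖ := norm_add_le _ _
        _ ≤ _ := by linarith) (φ i w) (hroot w hw1 i)
    refine h1.trans ?_
    gcongr
    exact le_max_right _ _
  rcases le_or_gt ‖y - x'‖ ε2 with hle | hgt
  · refine (hsmall y hle).trans ?_
    gcongr
  set l := ‖y - x'‖ with hl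
  have hl0 : 0 < l := hε2.trans hgt
  have hl0' : (l : ℂ) ≠ 0 := by exact_mod_cast hl0.ne'
  set v : Fin k → ℂ := (l : ℂ)⁻¹ • (y - x') with hv
  have hvn : ‖v‖ = 1 := by
    rw [hv, norm_smul, norm_inv, Complex.norm_real, Real.norm_of_nonneg hl0.le, ← hl]
    field_simp
  have hnt : ∀ t : ℂ, ‖(x' + t • v) - x'‖ = ‖t‖ := by
    intro t
    rw [add_sub_cancel_left, norm_smul, hvn, mul_one]
  have key := three_circles (fun t => Fval c (x' + t • v) (φ i (x' + t • v))) ε2 (ρ * (7/10))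
    (C3 ^ n * M ^ (1 - α)) (C3 ^ n * M) hε2 (by linarith)
    (fun t ht => by
      have h1 := (analyticAt_Fval c (φ i) (x' + t • v) (ha i _ (hin _ (by rw [hnt]; exact ht)))).differentiableAt
      have h2 : DifferentiableAt ℂ (fun t : ℂ => x' + t • v) t := by fun_prop
      exact DifferentiableAt.comp (g := fun y => Fval c y (φ i y)) t h1 h2)
    (fun t ht => hsmall _ (by rw [hnt]; exact ht))
    (fun t ht => hbig _ (by rw [hnt]; exact ht)) (l : ℂ)
    (by rw [Complex.norm_real, Real.norm_of_nonneg hl0.le]; exact hgt.le)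
    (by rw [Complex.norm_real, Real.norm_of_nonneg hl0.le]; linarith)
  have hxy : x' + (l : ℂ) • v = y := by
    rw [hv, smul_smul, mul_inv_cancel₀ hl0', one_smul]; simp
  simp only [hxy] at key
  rw [Complex.norm_real, Real.norm_of_nonneg hl0.le] at key
  set s := (Real.log l - Real.log ε2) / (Real.log (ρ * (7/10)) - Real.log ε2) with hs
  have hss0 : s ≤ s0 := by
    rw [hs, hs0]
    have : Real.log l ≤ Real.log (ρ * (6/10)) := Real.log_le_log hl0 hyx'
    have : 0 ≤ Real.log (ρ * (7/10)) - Real.log ε2 := by linarith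
    gcongr
  refine key.trans ?_
  have hCn : 0 < C3 ^ n := by positivity
  rw [Real.mul_rpow hCn.le (by positivity), Real.mul_rpow hCn.le hM0.le, ← Real.rpow_mul hM0.le]
  have : (C3 ^ n) ^ (1 - s) * M ^ ((1 - α) * (1 - s)) * ((C3 ^ n) ^ s * M ^ s) =
      ((C3 ^ n) ^ (1 - s) * (C3 ^ n) ^ s) * (M ^ ((1 - α) * (1 - s)) * M ^ s) := by ring
  rw [this, ← Real.rpow_add hCn, ← Real.rpow_add hM0]
  have h1 : 1 - s + s = 1 := by ring
  rw [h1, Real.rpow_one]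
  gcongr
  · exact hT.M_one
  · nlinarith

lemma vanish_ball (p : MvPolynomial (Fin k) ℂ) (x0 : Fin k → ℂ)
    (h : ∀ᶠ x in 𝓝 x0, eval x p = 0) : p = 0 := by
  obtain ⟨ρ, hρ, h⟩ := Metric.eventually_nhds_iff_ball.1 h
  apply MvPolynomial.funext
  intro x
  obtain ⟨C, -, hC⟩ := bw_multi x0 ρ ‖x‖ hρ
  have := hC p.totalDegree p le_rfl 0 (fun y hy => by simp [h y hy]) x le_rfl
  simpa using this

lemma coeff_prod_bound {ι : Type*} (s : Finset ι) (a : ι → ℂ) (T : ℝ) (h : ∀ i ∈ s, ‖a i‖ ≤ T)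
    (hT : 0 ≤ T) (j : ℕ) :
    ‖(∏ i ∈ s, (Polynomial.X - Polynomial.C (a i))).coeff j‖ ≤ (1 + T) ^ s.card := by
  classical
  induction s using Finset.induction_on generalizing j with
  | empty =>
    simp only [Finset.prod_empty, Finset.card_empty, pow_zero, Polynomial.coeff_one]
    split_ifs <;> simp
  | insert b s hb ih =>
    have ih' := ih (fun i hi => h i (Finset.mem_insert_of_mem hi))
    rw [Finset.prod_insert hb, Finset.card_insert_of_notMem hb, sub_mul, Polynomial.coeff_sub,
      Polynomial.coeff_C_mul]
    refine (norm_sub_le _ _).trans ?_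
    rw [norm_mul]
    have h1 : ‖(Polynomial.X * ∏ i ∈ s, (Polynomial.X - Polynomial.C (a i))).coeff j‖ ≤ (1 + T) ^ s.card := by
      cases j with
      | zero => simp; positivity
      | succ j => rw [Polynomial.coeff_X_mul]; exact ih' j
    have h2 := ih' j
    have h3 := h b (Finset.mem_insert_self _ _)
    calc _ ≤ (1+T) ^ s.card + T * (1 + T) ^ s.card := by gcongr
      _ = _ := by ring

lemma coeff_prod_analytic {ι : Type*} (s : Finset ι) (φ : ι → (Fin k → ℂ) → ℂ) (x : Fin k → ℂ)
    (h : ∀ i ∈ s, AnalyticAt ℂ (φ i) x) (j : ℕ) :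
    AnalyticAt ℂ (fun y => (∏ i ∈ s, (Polynomial.X - Polynomial.C (φ i y))).coeff j) x := by
  classical
  induction s using Finset.induction_on generalizing j with
  | empty => simp only [Finset.prod_empty]; exact analyticAt_const
  | insert b s hb ih =>
    have ih' := ih (fun i hi => h i (Finset.mem_insert_of_mem hi))
    simp only [Finset.prod_insert hb, sub_mul, Polynomial.coeff_sub, Polynomial.coeff_C_mul]
    refine AnalyticAt.fun_sub ?_ ((h b (Finset.mem_insert_self _ _)).mul (ih' j))
    cases j with
    | zero => simp only [Polynomial.coeff_X_mul_zero]; exact analyticAt_const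
    | succ j => simp only [Polynomial.coeff_X_mul]; exact ih' j

end BW
end

section
open scoped Topology
namespace BW
variable {k : ℕ}

open Classical in
/-- The factor of `P` (fibrewise) formed by the good roots. -/
noncomputable def Qg (P : Polynomial (MvPolynomial (Fin k) ℂ)) (Δ : MvPolynomial (Fin k) ℂ)
    (x0 : Fin k → ℂ) (τ0 : ℂ) (r : ℝ) (x : Fin k → ℂ) : Polynomial ℂ :=
  ∏ τ ∈ (P.map (eval x)).roots.toFinset.filter (fun τ => Good P Δ x0 τ0 r x τ),
    (Polynomial.X - Polynomial.C τ)

lemma Qg_local (P : Polynomial (MvPolynomial (Fin k) ℂ)) (hP : P.Monic)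
    (Δ : MvPolynomial (Fin k) ℂ) (hsep : ∀ x, eval x Δ ≠ 0 → (P.map (eval x)).Separable)
    (x0 : Fin k → ℂ) (τ0 : ℂ) (r : ℝ) (h0 : eval x0 Δ ≠ 0)
    (x1 : Fin k → ℂ) (h1 : eval x1 Δ ≠ 0) :
    ∃ ρ : ℝ, 0 < ρ ∧ ∃ φ : Fin P.natDegree → (Fin k → ℂ) → ℂ, ∃ I : Finset (Fin P.natDegree),
      (∀ i, ∀ x ∈ ball x1 ρ, AnalyticAt ℂ (φ i) x) ∧
      (∀ x ∈ ball x1 ρ, P.map (eval x) = ∏ i, (Polynomial.X - Polynomial.C (φ i x))) ∧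
      (∀ x ∈ ball x1 ρ, Qg P Δ x0 τ0 r x = ∏ i ∈ I, (Polynomial.X - Polynomial.C (φ i x))) ∧
      (∀ x ∈ ball x1 ρ, ∀ i, i ∈ I ↔ Good P Δ x0 τ0 r x (φ i x)) := by
  classical
  obtain ⟨ρ1, hρ1, φ, ha, hinj, hprod⟩ := sheets P hP x1 (hsep x1 h1)
  obtain ⟨ρ2, hρ2, hΔ⟩ := Metric.eventually_nhds_iff_ball.1
    ((continuous_eval' Δ).continuousAt.eventually_ne h1)
  set ρ := min ρ1 ρ2
  have hρ : 0 < ρ := lt_min hρ1 hρ2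
  have s1 : ball x1 ρ ⊆ ball x1 ρ1 := ball_subset_ball (min_le_left _ _)
  have s2 : ball x1 ρ ⊆ ball x1 ρ2 := ball_subset_ball (min_le_right _ _)
  have s4 : ball x1 (ρ/4) ⊆ ball x1 ρ := ball_subset_ball (by linarith)
  have hc : x1 ∈ ball x1 (ρ/4) := mem_ball_self (by linarith)
  have key : ∀ x ∈ ball x1 (ρ/4), ∀ i, Good P Δ x0 τ0 r x1 (φ i x1) ↔ Good P Δ x0 τ0 r x (φ i x) := by
    intro x hx i
    constructor
    · exact good_spread P hP Δ x0 τ0 r (hsep x0 h0) x1 ρ hρ φ (fun i x hx => ha i x (s1 hx))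
        (fun x hx => hinj x (s1 hx)) (fun x hx => hprod x (s1 hx)) (fun x hx => hΔ x (s2 hx)) i x1 x hc hx
    · exact good_spread P hP Δ x0 τ0 r (hsep x0 h0) x1 ρ hρ φ (fun i x hx => ha i x (s1 hx))
        (fun x hx => hinj x (s1 hx)) (fun x hx => hprod x (s1 hx)) (fun x hx => hΔ x (s2 hx)) i x x1 hx hc
  refine ⟨ρ/4, by linarith, φ, Finset.univ.filter (fun i => Good P Δ x0 τ0 r x1 (φ i x1)),
    fun i x hx => ha i x (s1 (s4 hx)), fun x hx => hprod x (s1 (s4 hx)), ?_, ?_⟩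
  · intro x hx
    have e : (P.map (eval x)).roots.toFinset.filter (fun τ => Good P Δ x0 τ0 r x τ)
        = (Finset.univ.filter (fun i => Good P Δ x0 τ0 r x1 (φ i x1))).image (fun i => φ i x) := by
      ext τ
      simp only [Finset.mem_filter, Multiset.mem_toFinset, Finset.mem_image, Finset.mem_univ, true_and]
      rw [Polynomial.mem_roots (hP.map _).ne_zero]
      constructor
      · rintro ⟨hr, hg⟩
        rw [hprod x (s1 (s4 hx)), Polynomial.IsRoot, Polynomial.eval_prod, Finset.prod_eq_zero_iff] at hr
        obtain ⟨i, -, hi⟩ := hr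
        have : τ = φ i x := by simpa [sub_eq_zero] using hi
        subst this
        exact ⟨i, (key x hx i).2 hg, rfl⟩
      · rintro ⟨i, hi, rfl⟩
        have := (key x hx i).1 hi
        exact ⟨this.2.1, this⟩
    unfold Qg
    rw [e, Finset.prod_image]
    intro i _ j _ h
    exact hinj x (s1 (s4 hx)) h
  · intro x hx i
    simp [key x hx i]

lemma Qg_growth (P : Polynomial (MvPolynomial (Fin k) ℂ)) (hP : P.Monic)
    (Δ : MvPolynomial (Fin k) ℂ) (x0 : Fin k → ℂ) (τ0 : ℂ) (r : ℝ) :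
    ∃ S : ℕ, ∀ v : Fin k → ℂ, ∃ C : ℝ, ∀ t : ℂ, ∀ j,
      ‖(Qg P Δ x0 τ0 r (x0 + t • v)).coeff j‖ ≤ C * (1 + ‖t‖) ^ S := by
  classical
  set D := ∑ i ∈ Finset.range P.natDegree, (P.coeff i).totalDegree
  refine ⟨D * P.natDegree, fun v => ?_⟩
  choose C hC0 hC using fun i => eval_line_growth (P.coeff i) x0 v
  set C' := 2 + ∑ i ∈ Finset.range P.natDegree, C i
  refine ⟨C' ^ P.natDegree, fun t j => ?_⟩
  set x := x0 + t • v
  set T := 1 + ∑ i ∈ Finset.range P.natDegree, ‖eval x (P.coeff i)‖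
  have hT1 : 1 ≤ T := le_add_of_nonneg_right (Finset.sum_nonneg fun _ _ => norm_nonneg _)
  have ht : (1:ℝ) ≤ 1 + ‖t‖ := by linarith [norm_nonneg t]
  have hTb : 1 + T ≤ C' * (1 + ‖t‖) ^ D := by
    have : ∑ i ∈ Finset.range P.natDegree, ‖eval x (P.coeff i)‖
        ≤ ∑ i ∈ Finset.range P.natDegree, C i * (1 + ‖t‖) ^ D := by
      apply Finset.sum_le_sum
      intro i hi
      refine (hC i t).trans ?_
      apply mul_le_mul_of_nonneg_left _ (hC0 i)
      exact pow_le_pow_right₀ ht (Finset.single_le_sum (f := fun i => (P.coeff i).totalDegree)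
        (fun _ _ => Nat.zero_le _) hi)
    rw [← Finset.sum_mul] at this
    have h2 : (1:ℝ) ≤ (1 + ‖t‖) ^ D := one_le_pow₀ ht
    simp only [T, C']
    nlinarith
  unfold Qg
  refine (coeff_prod_bound _ (fun τ => τ) T ?_ (by linarith) j).trans ?_
  · intro τ hτ
    simp only [Finset.mem_filter, Multiset.mem_toFinset] at hτ
    exact root_bound P hP x τ hτ.2.2.1
  · rw [pow_mul, ← mul_pow]
    refine (pow_le_pow_right₀ (by linarith) ?_).trans (pow_le_pow_left₀ (by linarith) hTb _)
    refine (Finset.card_filter_le _ _).trans ((Multiset.toFinset_card_le _).trans ?_)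
    exact (Polynomial.card_roots' _).trans (Polynomial.natDegree_map_le)

lemma coeff_poly (P : Polynomial (MvPolynomial (Fin k) ℂ)) (hP : P.Monic)
    (Δ : MvPolynomial (Fin k) ℂ) (hsep : ∀ x, eval x Δ ≠ 0 → (P.map (eval x)).Separable)
    (x0 : Fin k → ℂ) (τ0 : ℂ) (r : ℝ) (h0 : eval x0 Δ ≠ 0) (j : ℕ) :
    ∃ p : MvPolynomial (Fin k) ℂ, ∀ᶠ x in 𝓝 x0, eval x p = (Qg P Δ x0 τ0 r x).coeff j := by
  have han : ∀ x1, eval x1 Δ ≠ 0 → AnalyticAt ℂ (fun x => (Qg P Δ x0 τ0 r x).coeff j) x1 := by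
    intro x1 h1
    obtain ⟨ρ, hρ, φ, I, ha, -, hQ, -⟩ := Qg_local P hP Δ hsep x0 τ0 r h0 x1 h1
    refine (coeff_prod_analytic I φ x1 (fun i _ => ha i x1 (mem_ball_self hρ)) j).congr ?_
    filter_upwards [ball_mem_nhds x1 hρ] with x hx
    rw [hQ x hx]
  obtain ⟨S, hS⟩ := Qg_growth P hP Δ x0 τ0 r
  refine poly_of_lines _ x0 (han x0 h0) S fun v => ?_
  obtain ⟨C, hC⟩ := hS v
  obtain ⟨g, -, hg⟩ := line_poly Δ x0 v
  have hg0 : g ≠ 0 := by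
    rintro rfl
    have := hg 0
    simp at this
    exact h0 this.symm
  have hfin : {t : ℂ | g.IsRoot t}.Finite := Polynomial.finite_setOfPred_isRoot hg0
  obtain ⟨h, hd, he, hb⟩ := exists_entire (fun t => (Qg P Δ x0 τ0 r (x0 + t • v)).coeff j)
    {t | g.IsRoot t} hfin (by
      intro t ht
      have h1 : eval (x0 + t • v) Δ ≠ 0 := by rw [← hg]; exact ht
      have := (han _ h1).differentiableAt
      exact DifferentiableAt.comp (g := fun x => (Qg P Δ x0 τ0 r x).coeff j) t this (by fun_prop)) C S (fun t => hC t j)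
  refine ⟨h, hd, ?_, C, hb⟩
  have : (0:ℂ) ∉ {t | g.IsRoot t} := by
    intro hh
    have := hg 0
    rw [Set.mem_ofPred_eq, Polynomial.IsRoot.def] at hh
    rw [hh] at this
    simp at this
    exact h0 this.symm
  filter_upwards [hfin.isClosed.isOpen_compl.mem_nhds this] with t ht
  exact he t ht

lemma all_good (P : Polynomial (MvPolynomial (Fin k) ℂ)) (hP : P.Monic) (hirr : Irreducible P)
    (Δ : MvPolynomial (Fin k) ℂ) (hsep : ∀ x, eval x Δ ≠ 0 → (P.map (eval x)).Separable)
    (x0 : Fin k → ℂ) (τ0 : ℂ) (r : ℝ) (hr : 0 < r) (h0 : eval x0 Δ ≠ 0)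
    (hτ : (P.map (eval x0)).eval τ0 = 0) (τ : ℂ) (hτ1 : (P.map (eval x0)).eval τ = 0) :
    Good P Δ x0 τ0 r x0 τ := by
  classical
  obtain ⟨ρ, hρ, φ, I, ha, hprod, hQ, hI⟩ := Qg_local P hP Δ hsep x0 τ0 r h0 x0 h0
  have hc : x0 ∈ ball x0 ρ := mem_ball_self hρ
  choose p hp using fun j => coeff_poly P hP Δ hsep x0 τ0 r h0 j
  have hrt : ∀ σ, (P.map (eval x0)).eval σ = 0 → ∃ i, σ = φ i x0 := by
    intro σ hσ
    rw [hprod x0 hc, Polynomial.eval_prod, Finset.prod_eq_zero_iff] at hσ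
    obtain ⟨i, -, hi⟩ := hσ
    exact ⟨i, by simpa [sub_eq_zero] using hi⟩
  obtain ⟨i0, hi0⟩ := hrt τ0 hτ
  have hi0I : i0 ∈ I := by
    rw [hI x0 hc, ← hi0]
    exact good_base P Δ x0 τ0 r hr h0 hτ
  set d := I.card
  set Q : Polynomial (MvPolynomial (Fin k) ℂ) :=
    Polynomial.X ^ d + ∑ j ∈ Finset.range d, Polynomial.C (p j) * Polynomial.X ^ j with hQdef
  have hdeg : (∑ j ∈ Finset.range d, Polynomial.C (p j) * Polynomial.X ^ j).degree < (d : WithBot ℕ) := by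
    refine (Polynomial.degree_sum_le _ _).trans_lt ?_
    rw [Finset.sup_lt_iff (by exact WithBot.bot_lt_coe _)]
    intro j hj
    refine (Polynomial.degree_C_mul_X_pow_le _ _).trans_lt ?_
    exact_mod_cast Finset.mem_range.1 hj
  have hQm : Q.Monic := Polynomial.monic_X_pow_add hdeg
  have hQd : Q.natDegree = d := by
    apply Polynomial.natDegree_eq_of_degree_eq_some
    rw [hQdef, Polynomial.degree_add_eq_left_of_degree_lt, Polynomial.degree_X_pow]
    rwa [Polynomial.degree_X_pow]
  have hQx : ∀ᶠ x in 𝓝 x0, Q.map (eval x) = ∏ i ∈ I, (Polynomial.X - Polynomial.C (φ i x)) := by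
    have : ∀ᶠ x in 𝓝 x0, ∀ j ∈ Finset.range d, eval x (p j) = (Qg P Δ x0 τ0 r x).coeff j :=
      (Finset.eventually_all _).2 fun j _ => hp j
    filter_upwards [this, ball_mem_nhds x0 hρ] with x hx hxb
    have hmon : (∏ i ∈ I, (Polynomial.X - Polynomial.C (φ i x))).Monic :=
      Polynomial.monic_prod_of_monic _ _ fun i _ => Polynomial.monic_X_sub_C _
    have hnd : (∏ i ∈ I, (Polynomial.X - Polynomial.C (φ i x))).natDegree = d := by
      rw [Polynomial.natDegree_prod_of_monic _ _ fun i _ => Polynomial.monic_X_sub_C _]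
      simp [d]
    conv_rhs => rw [hmon.as_sum, hnd]
    rw [hQdef, Polynomial.map_add, Polynomial.map_pow, Polynomial.map_X, Polynomial.map_sum]
    congr 1
    apply Finset.sum_congr rfl
    intro j hj
    rw [Polynomial.map_mul, Polynomial.map_C, Polynomial.map_pow, Polynomial.map_X, hx j hj, hQ x hxb]
  have hmod : P %ₘ Q = 0 := by
    ext1 j
    rw [Polynomial.coeff_zero]
    apply vanish_ball _ x0
    filter_upwards [hQx, ball_mem_nhds x0 hρ] with x hx hxb
    have : (P %ₘ Q).map (eval x) = 0 := by
      rw [Polynomial.map_modByMonic _ hQm, Polynomial.modByMonic_eq_zero_iff_dvd (hQm.map _), hx, hprod x hxb]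
      exact Finset.prod_dvd_prod_of_subset _ _ _ (Finset.subset_univ _)
    rw [← Polynomial.coeff_map, this, Polynomial.coeff_zero]
  rw [Polynomial.modByMonic_eq_zero_iff_dvd hQm] at hmod
  obtain ⟨R, hR⟩ := hmod
  have hd0 : 0 < d := Finset.card_pos.2 ⟨i0, hi0I⟩
  have hQu : ¬ IsUnit Q := by
    intro hu
    have := (hQm.isUnit_iff).1 hu
    rw [this] at hQd
    simp at hQd
    omega
  have hRu : IsUnit R := (hirr.isUnit_or_isUnit hR).resolve_left hQu
  have hRm : R.Monic := hQm.of_mul_monic_left (hR ▸ hP)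
  rw [hRm.isUnit_iff] at hRu
  rw [hRu, mul_one] at hR
  have hIu : I = Finset.univ := by
    rw [← Finset.card_eq_iff_eq_univ, Fintype.card_fin]
    exact hQd.symm.trans (congrArg Polynomial.natDegree hR.symm)
  obtain ⟨i, hi⟩ := hrt τ hτ1
  rw [hi]
  exact (hI x0 hc i).1 (by rw [hIu]; exact Finset.mem_univ i)

theorem thmH (P : Polynomial (MvPolynomial (Fin k) ℂ)) (hP : P.Monic) (hirr : Irreducible P)
    (Δ : MvPolynomial (Fin k) ℂ) (hsep : ∀ x, eval x Δ ≠ 0 → (P.map (eval x)).Separable)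
    (x0 : Fin k → ℂ) (τ0 : ℂ) (r : ℝ) (hr : 0 < r) (h0 : eval x0 Δ ≠ 0)
    (hτ : (P.map (eval x0)).eval τ0 = 0) (R : ℝ) :
    ∃ C : ℝ, 1 ≤ C ∧ ∀ n : ℕ, 1 ≤ n → ∀ c : Fin P.natDegree → MvPolynomial (Fin k) ℂ,
      (∀ j, (c j).totalDegree ≤ n) →
      (∀ x ∈ ball x0 r, ∀ τ ∈ ball τ0 r, (P.map (eval x)).eval τ = 0 → ‖Fval c x τ‖ ≤ 1) →
      ∀ x, ‖x‖ ≤ R → ∀ τ, (P.map (eval x)).eval τ = 0 → ‖Fval c x τ‖ ≤ C ^ n := by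
  obtain ⟨ρ, hρ, φ, ha, hinj, hprod⟩ := sheets P hP x0 (hsep x0 h0)
  have hc : x0 ∈ ball x0 ρ := mem_ball_self hρ
  have hroot : ∀ x ∈ ball x0 ρ, ∀ σ, (P.map (eval x)).eval σ = 0 ↔ ∃ i, σ = φ i x := by
    intro x hx σ
    rw [hprod x hx, Polynomial.eval_prod, Finset.prod_eq_zero_iff]
    simp [sub_eq_zero]
  have hgood : ∀ i, Good P Δ x0 τ0 r x0 (φ i x0) := fun i =>
    all_good P hP hirr Δ hsep x0 τ0 r hr h0 hτ _ ((hroot x0 hc _).2 ⟨i, rfl⟩)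
  choose _ _ ε hε C hC α hα hα1 hT using hgood
  obtain ⟨i0, -⟩ := (hroot x0 hc _).1 hτ
  have : Nonempty (Fin P.natDegree) := ⟨i0⟩
  obtain ⟨ia, hia⟩ := Finite.exists_min α
  obtain ⟨ic, hic⟩ := Finite.exists_max C
  have hcont : ∀ᶠ x in 𝓝 x0, x ∈ ball x0 ρ ∧ ∀ i, x ∈ ball x0 (ε i) ∧ φ i x ∈ ball (φ i x0) (ε i) := by
    refine Filter.Eventually.and (ball_mem_nhds x0 hρ) (eventually_all.2 fun i => ?_)
    exact Filter.Eventually.and (ball_mem_nhds x0 (hε i))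
      ((ha i x0 hc).continuousAt.eventually_mem (ball_mem_nhds _ (hε i)))
  obtain ⟨ε', hε', hcont⟩ := Metric.eventually_nhds_iff_ball.1 hcont
  obtain ⟨C2, hC2, hgb⟩ := global_bound P hP x0 (hsep x0 h0) ε' (‖x0‖ + 1) hε'
  obtain ⟨C3, hC3, hgb3⟩ := global_bound P hP x0 (hsep x0 h0) 1 R one_pos
  set D := C2 * C ic
  have hD : 1 ≤ D := one_le_mul_of_one_le_of_one_le hC2 (hC ic)
  have hD0 : 0 ≤ D := by linarith
  refine ⟨C3 * D ^ (1 / α ia), one_le_mul_of_one_le_of_one_le hC3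
    (Real.one_le_rpow hD (by have := hα ia; positivity)), ?_⟩
  intro n hn c hdeg hsmall
  have hnorm : ∀ x ∈ ball x0 1, ‖x‖ ≤ ‖x0‖ + 1 := by
    intro x hx
    rw [mem_ball, dist_eq_norm] at hx
    have := norm_sub_norm_le x x0
    linarith
  set Sv : Set ℝ := {1} ∪ {y | ∃ x ∈ ball x0 1, ∃ τ, (P.map (eval x)).eval τ = 0 ∧ y = ‖Fval c x τ‖}
  have hbdd : BddAbove Sv := by
    obtain ⟨T, hT1, hTb⟩ := root_bound_ball P hP (‖x0‖ + 1)
    choose B hB0 hB using fun j => eval_bounded (c j) (‖x0‖ + 1)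
    refine ⟨1 + ∑ j, B j * T ^ (j : ℕ), ?_⟩
    have hpos : 0 ≤ ∑ j, B j * T ^ (j : ℕ) :=
      Finset.sum_nonneg fun j _ => mul_nonneg (hB0 j) (by positivity)
    rintro y (hy | ⟨x, hx, τ, h, rfl⟩)
    · rw [Set.mem_singleton_iff] at hy; linarith
    · have : ‖Fval c x τ‖ ≤ ∑ j, B j * T ^ (j : ℕ) := by
        unfold Fval
        refine (norm_sum_le _ _).trans (Finset.sum_le_sum fun j _ => ?_)
        rw [norm_mul, norm_pow]
        have h1 := hB j x (hnorm x hx)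
        have h2 := hTb x (hnorm x hx) τ h
        have := hB0 j
        gcongr
      linarith
  set M := sSup Sv
  have hM1 : 1 ≤ M := le_csSup hbdd (Or.inl rfl)
  have hM0 : 0 < M := by linarith
  have hMb : ∀ x ∈ ball x0 1, ∀ τ, (P.map (eval x)).eval τ = 0 → ‖Fval c x τ‖ ≤ M :=
    fun x hx τ h => le_csSup hbdd (Or.inr ⟨x, hx, τ, h, rfl⟩)
  have htest : Test P x0 τ0 r n c M := ⟨hn, hdeg, hM1, hsmall, hMb⟩
  have hmain : ∀ x ∈ ball x0 1, ∀ τ, (P.map (eval x)).eval τ = 0 →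
      ‖Fval c x τ‖ ≤ C2 ^ n * (C ic ^ n * M ^ (1 - α ia)) := by
    intro x hx τ h
    refine hgb n hn c hdeg _ (by have := hC ic; positivity) ?_ x (hnorm x hx) τ h
    intro y hy σ hσ
    obtain ⟨hy1, hy2⟩ := hcont y hy
    obtain ⟨i, rfl⟩ := (hroot y hy1 σ).1 hσ
    refine (hT i n c M htest y (hy2 i).1 _ (hy2 i).2 hσ).trans ?_
    have h1 := hC i
    have h2 := hic i
    have h3 := hia i
    have h4 : 0 ≤ C ic := by linarith
    have h5 : M ^ (1 - α i) ≤ M ^ (1 - α ia) := Real.rpow_le_rpow_of_exponent_le hM1 (by linarith)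
    have h6 : C i ^ n ≤ C ic ^ n := pow_le_pow_left₀ (by linarith) h2 n
    exact mul_le_mul h6 h5 (by positivity) (by positivity)
  have hMle : M ≤ D ^ n * M ^ (1 - α ia) := by
    refine csSup_le (⟨1, Or.inl rfl⟩ : Sv.Nonempty) ?_
    rintro y (hy | ⟨x, hx, τ, h, rfl⟩)
    · rw [Set.mem_singleton_iff] at hy
      rw [hy]
      exact one_le_mul_of_one_le_of_one_le (one_le_pow₀ hD)
        (Real.one_le_rpow hM1 (by linarith [hα1 ia]))
    · refine (hmain x hx τ h).trans (le_of_eq ?_)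
      simp only [D]; rw [mul_pow]; ring
  have hMα : M ^ α ia ≤ D ^ n := by
    have h1 : M ^ (1 - α ia) * M ^ (α ia) = M := by
      rw [← Real.rpow_add hM0]; simp
    have h2 : 0 < M ^ (1 - α ia) := Real.rpow_pos_of_pos hM0 _
    rw [← mul_le_mul_iff_right₀ h2, h1]
    linarith [mul_comm (M ^ (1 - α ia)) (D ^ n)]
  have hMf : M ≤ (D ^ (1 / α ia)) ^ n := by
    have h1 : M = (M ^ α ia) ^ (1 / α ia) := by
      rw [← Real.rpow_mul hM0.le, mul_one_div_cancel (hα ia).ne', Real.rpow_one]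
    rw [h1]
    refine (Real.rpow_le_rpow (by positivity) hMα (by have := hα ia; positivity)).trans (le_of_eq ?_)
    rw [← Real.rpow_natCast, ← Real.rpow_natCast, ← Real.rpow_mul hD0, ← Real.rpow_mul hD0, mul_comm]
  intro x hx τ h
  rw [mul_pow]
  refine (hgb3 n hn c hdeg M hM0.le hMb x hx τ h).trans ?_
  gcongr
end BW
end

section
open scoped Topology
namespace BW

open scoped IntermediateField in
lemma exists_prim {A B : Type*} [CommRing A] [IsDomain A] [CharZero A]
    [CommRing B] [IsDomain B] [Algebra A B] [Module.Finite A B] [FaithfulSMul A B] :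
    ∃ θ : B, ∀ b : B, ∃ Δ : A, Δ ≠ 0 ∧ ∃ f : Polynomial A,
      algebraMap A B Δ * b = Polynomial.aeval θ f := by
  let K := FractionRing A
  let L := FractionRing B
  let _ : Algebra K L := FractionRing.liftAlgebra A L
  have : CharZero K := IsFractionRing.charZero_of_isFractionRing A
  obtain ⟨α, hα⟩ := Field.exists_primitive_element K L
  obtain ⟨b, s, hs, rfl⟩ := IsFractionRing.div_surjective B (K := FractionRing B) α
  have hIntg : ∀ y : B, IsIntegral A y := fun y => Algebra.IsIntegral.isIntegral y
  have hinjA : Function.Injective (algebraMap A B) := FaithfulSMul.algebraMap_injective A B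
  have hinjB : Function.Injective (algebraMap B L) := IsFractionRing.injective B L
  obtain ⟨a, ha, s', hs'⟩ := ((hIntg s).isAlgebraic).exists_nonzero_dvd hs
  have ha' : algebraMap B L (algebraMap A B a) ≠ 0 := by
    rw [Ne, map_eq_zero_iff _ hinjB, map_eq_zero_iff _ hinjA]; exact ha
  have hs0 : algebraMap B L s ≠ 0 := by
    rw [Ne, map_eq_zero_iff _ hinjB]; exact nonZeroDivisors.ne_zero hs
  set θ := b * s'
  have hθ : algebraMap B L θ = algebraMap K L (algebraMap A K a) * (algebraMap B L b / algebraMap B L s) := by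
    rw [← IsScalarTower.algebraMap_apply A K L, IsScalarTower.algebraMap_apply A B L, hs']
    simp only [θ, map_mul]
    rw [mul_div_assoc', eq_div_iff hs0]; ring
  have htop : K⟮algebraMap B L θ⟯ = ⊤ := by
    rw [eq_top_iff, ← hα, IntermediateField.adjoin_simple_le_iff]
    have h1 : algebraMap B L b / algebraMap B L s = algebraMap B L θ / algebraMap K L (algebraMap A K a) := by
      rw [hθ, mul_div_cancel_left₀]
      rwa [← IsScalarTower.algebraMap_apply A K L, IsScalarTower.algebraMap_apply A B L]
    rw [h1]
    exact div_mem (IntermediateField.mem_adjoin_simple_self K _) (algebraMap_mem _ _)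
  have halg : IsAlgebraic K (algebraMap B L θ) := Algebra.IsAlgebraic.isAlgebraic _
  refine ⟨θ, fun y => ?_⟩
  have hy : algebraMap B L y ∈ Algebra.adjoin K {algebraMap B L θ} := by
    rw [← IntermediateField.adjoin_simple_toSubalgebra_of_isAlgebraic halg, htop]
    trivial
  rw [Algebra.adjoin_singleton_eq_range_aeval] at hy
  obtain ⟨f, hf⟩ := hy
  obtain ⟨d, hdm, hd⟩ := IsLocalization.integerNormalization_spec (nonZeroDivisors A) f
  refine ⟨d, nonZeroDivisors.ne_zero hdm, IsLocalization.integerNormalization (nonZeroDivisors A) f, ?_⟩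
  apply hinjB
  rw [← Polynomial.aeval_algebraMap_apply, map_mul, ← Polynomial.aeval_map_algebraMap K, hd, ← hf]
  rw [← IsScalarTower.algebraMap_apply A B L, IsScalarTower.algebraMap_apply A K L]
  simp [Algebra.smul_def]

lemma primitive {A B : Type*} [CommRing A] [IsDomain A] [CharZero A] [IsIntegrallyClosed A]
    [CommRing B] [IsDomain B] [Algebra A B] [Module.Finite A B] [FaithfulSMul A B] :
    ∃ θ : B, ∃ Δ : A, Δ ≠ 0 ∧ (∀ b : B, ∃ f : Polynomial A,
      f.natDegree < (minpoly A θ).natDegree ∧ algebraMap A B Δ * b = Polynomial.aeval θ f) ∧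
      ∃ U V : Polynomial A, U * minpoly A θ + V * (minpoly A θ).derivative = Polynomial.C Δ := by
  classical
  obtain ⟨θ, hθ⟩ := exists_prim (A := A) (B := B)
  have hIntg : ∀ y : B, IsIntegral A y := fun y => Algebra.IsIntegral.isIntegral y
  have hinjA : Function.Injective (algebraMap A B) := FaithfulSMul.algebraMap_injective A B
  choose D hD F hF using hθ
  obtain ⟨s, hs⟩ := (inferInstance : Module.Finite A B).fg_top
  set Δ1 := ∏ b ∈ s, D b
  have hΔ1 : Δ1 ≠ 0 := Finset.prod_ne_zero_iff.2 fun b _ => hD b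
  have h1 : ∀ b : B, ∃ f : Polynomial A, algebraMap A B Δ1 * b = Polynomial.aeval θ f := by
    intro b
    have hb : b ∈ Submodule.span A (s : Set B) := by rw [hs]; trivial
    induction hb using Submodule.span_induction with
    | mem b hb =>
      refine ⟨Polynomial.C (∏ b ∈ s.erase b, D b) * F b, ?_⟩
      rw [map_mul, ← hF, Polynomial.aeval_C, ← mul_assoc, ← map_mul, mul_comm (∏ b ∈ s.erase b, D b),
        Finset.mul_prod_erase _ _ hb]
    | zero => exact ⟨0, by simp⟩
    | add x y _ _ hx hy =>
      obtain ⟨f, hf⟩ := hx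
      obtain ⟨g, hg⟩ := hy
      exact ⟨f + g, by rw [mul_add, hf, hg, map_add]⟩
    | smul a x _ hx =>
      obtain ⟨f, hf⟩ := hx
      exact ⟨Polynomial.C a * f, by rw [map_mul, ← hf, Polynomial.aeval_C, Algebra.smul_def]; ring⟩
  set P := minpoly A θ with hPdef
  have hPm : P.Monic := minpoly.monic (hIntg θ)
  have hPd : 0 < P.natDegree := minpoly.natDegree_pos (hIntg θ)
  have hder : Polynomial.aeval θ P.derivative ≠ 0 := by
    intro h
    have hdvd := minpoly.isIntegrallyClosed_dvd (hIntg θ) h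
    have h0 : P.derivative ≠ 0 := by
      intro h0
      have := Polynomial.derivative_eq_zero.1 h0
      omega
    have h3 := Polynomial.degree_derivative_lt hPm.ne_zero
    obtain ⟨g, hg⟩ := hdvd
    have hg0 : g ≠ 0 := by rintro rfl; rw [mul_zero] at hg; exact h0 hg
    have h4 : P.derivative.degree = P.degree + g.degree := by
      rw [hg, ← hPdef, hPm.degree_mul_comm, Polynomial.degree_mul, add_comm]
    rw [h4, Polynomial.degree_eq_natDegree hPm.ne_zero, Polynomial.degree_eq_natDegree hg0] at h3
    norm_cast at h3
    omega
  obtain ⟨a, ha, s', hs'⟩ := ((hIntg (Polynomial.aeval θ P.derivative)).isAlgebraic).exists_nonzero_dvd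
    (mem_nonZeroDivisors_of_ne_zero hder)
  obtain ⟨V, hV⟩ := h1 s'
  have hz : Polynomial.aeval θ (Polynomial.C (Δ1 * a) - V * P.derivative) = 0 := by
    rw [map_sub, Polynomial.aeval_C, map_mul, map_mul, ← hV, hs']; ring
  obtain ⟨U, hU⟩ := minpoly.isIntegrallyClosed_dvd (hIntg θ) hz
  refine ⟨θ, Δ1 * a, mul_ne_zero hΔ1 ha, fun b => ?_, U, V, ?_⟩
  · obtain ⟨f, hf⟩ := h1 (algebraMap A B a * b)
    refine ⟨f %ₘ P, Polynomial.natDegree_modByMonic_lt _ hPm ?_, ?_⟩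
    · intro h; rw [h] at hPd; simp at hPd
    · rw [map_mul, mul_assoc, hf]
      conv_lhs => rw [← Polynomial.modByMonic_add_div f P]
      simp [hPdef]
  · rw [mul_comm U, ← hU]; ring

set_option linter.unusedSectionVars false
section points
variable {k : ℕ} {B : Type*} [CommRing B] [IsDomain B] [Algebra ℂ B]
  [Algebra (MvPolynomial (Fin k) ℂ) B] [IsScalarTower ℂ (MvPolynomial (Fin k) ℂ) B]
  [Module.Finite (MvPolynomial (Fin k) ℂ) B] [FaithfulSMul (MvPolynomial (Fin k) ℂ) B]

/-- The base point of a point. -/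
noncomputable def pr (φ : B →ₐ[ℂ] ℂ) : Fin k → ℂ :=
  fun i => φ (algebraMap (MvPolynomial (Fin k) ℂ) B (X i))

lemma eval_pr (φ : B →ₐ[ℂ] ℂ) (p : MvPolynomial (Fin k) ℂ) :
    eval (pr φ) p = φ (algebraMap (MvPolynomial (Fin k) ℂ) B p) := by
  have : (aeval (pr φ) : MvPolynomial (Fin k) ℂ →ₐ[ℂ] ℂ)
      = φ.comp (IsScalarTower.toAlgHom ℂ (MvPolynomial (Fin k) ℂ) B) := by
    apply MvPolynomial.algHom_ext
    intro i
    simp [pr]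
  have h := congrArg (fun g => g p) this
  simpa [MvPolynomial.aeval_eq_eval] using h

lemma eval_map_pr (φ : B →ₐ[ℂ] ℂ) (f : Polynomial (MvPolynomial (Fin k) ℂ)) (u : B) :
    (f.map (eval (pr φ))).eval (φ u) = φ (Polynomial.aeval u f) := by
  rw [Polynomial.eval_map, Polynomial.aeval_def]
  have := Polynomial.hom_eval₂ f (algebraMap (MvPolynomial (Fin k) ℂ) B) (φ : B →+* ℂ) u
  rw [RingHom.coe_coe] at this
  rw [this]
  congr 1
  refine RingHom.ext fun p => ?_
  rw [eval_pr]; rfl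

lemma minpoly_pr (φ : B →ₐ[ℂ] ℂ) (u : B) :
    ((minpoly (MvPolynomial (Fin k) ℂ) u).map (eval (pr φ))).eval (φ u) = 0 := by
  rw [eval_map_pr, minpoly.aeval, map_zero]

lemma hom_eq_of_ker (φ ψ : B →ₐ[ℂ] ℂ) (h : ∀ b, φ b = 0 → ψ b = 0) : φ = ψ := by
  ext b
  have := h (b - algebraMap ℂ B (φ b)) (by simp)
  simp [sub_eq_zero] at this
  exact this.symm

lemma lift_point (u : B) (x : Fin k → ℂ) (τ : ℂ)
    (h : ((minpoly (MvPolynomial (Fin k) ℂ) u).map (eval x)).eval τ = 0) :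
    ∃ φ : B →ₐ[ℂ] ℂ, pr φ = x ∧ φ u = τ := by
  let : Algebra (Polynomial (MvPolynomial (Fin k) ℂ)) B := (Polynomial.aeval u : (Polynomial (MvPolynomial (Fin k) ℂ)) →ₐ[(MvPolynomial (Fin k) ℂ)] B).toRingHom.toAlgebra
  have hmapR : ∀ f : (Polynomial (MvPolynomial (Fin k) ℂ)), algebraMap (Polynomial (MvPolynomial (Fin k) ℂ)) B f = Polynomial.aeval u f := fun f => rfl
  have : IsScalarTower (MvPolynomial (Fin k) ℂ) (Polynomial (MvPolynomial (Fin k) ℂ)) B := IsScalarTower.of_algebraMap_eq fun a => by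
    rw [hmapR, Polynomial.algebraMap_eq, Polynomial.aeval_C]
  have : Algebra.IsIntegral (Polynomial (MvPolynomial (Fin k) ℂ)) B := Algebra.IsIntegral.tower_top (MvPolynomial (Fin k) ℂ)
  let ψ : (Polynomial (MvPolynomial (Fin k) ℂ)) →+* ℂ := Polynomial.eval₂RingHom (eval x) τ
  have hψs : Function.Surjective ψ := fun c => ⟨Polynomial.C (C c), by simp [ψ]⟩
  have : (RingHom.ker ψ).IsMaximal := RingHom.ker_isMaximal_of_surjective ψ hψs
  obtain ⟨Q, hQ, hQc⟩ := Ideal.exists_ideal_over_maximal_of_isIntegral (S := B) (RingHom.ker ψ) (by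
    intro f hf
    rw [RingHom.mem_ker, hmapR] at hf
    obtain ⟨g, rfl⟩ := minpoly.isIntegrallyClosed_dvd (Algebra.IsIntegral.isIntegral u) hf
    rw [RingHom.mem_ker, map_mul]
    have : ψ (minpoly (MvPolynomial (Fin k) ℂ) u) = 0 := by
      rw [← h, Polynomial.eval_map]; rfl
    rw [this, zero_mul])
  let : Field (B ⧸ Q) := Ideal.Quotient.field Q
  have : Algebra.FiniteType ℂ (MvPolynomial (Fin k) ℂ) := inferInstance
  have : Algebra.FiniteType ℂ B := Algebra.FiniteType.trans (S := MvPolynomial (Fin k) ℂ) inferInstance inferInstance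
  have : Algebra.FiniteType ℂ (B ⧸ Q) := inferInstance
  have : Module.Finite ℂ (B ⧸ Q) := finite_of_finite_type_of_isJacobsonRing ℂ (B ⧸ Q)
  have hbij := IsAlgClosed.algebraMap_bijective_of_isIntegral (k := ℂ) (K := B ⧸ Q)
  let e : ℂ ≃ₐ[ℂ] (B ⧸ Q) := AlgEquiv.ofBijective (Algebra.ofId ℂ (B ⧸ Q)) hbij
  let φ : B →ₐ[ℂ] ℂ := (e.symm : (B ⧸ Q) →ₐ[ℂ] ℂ).comp (Ideal.Quotient.mkₐ ℂ Q)
  have hφ : ∀ b ∈ Q, φ b = 0 := by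
    intro b hb
    simp [φ, Ideal.Quotient.eq_zero_iff_mem.2 hb]
  have key : ∀ f : (Polynomial (MvPolynomial (Fin k) ℂ)), φ (Polynomial.aeval u f) = ψ f := by
    intro f
    have h1 : f - Polynomial.C (C (ψ f)) ∈ RingHom.ker ψ := by
      rw [RingHom.mem_ker, map_sub]; simp [ψ]
    rw [← hQc, Ideal.mem_comap, hmapR] at h1
    have h2 := hφ _ h1
    rw [map_sub, map_sub, sub_eq_zero, Polynomial.aeval_C] at h2
    rw [h2]
    have : algebraMap (MvPolynomial (Fin k) ℂ) B (C (ψ f)) = algebraMap ℂ B (ψ f) := by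
      rw [IsScalarTower.algebraMap_apply ℂ (MvPolynomial (Fin k) ℂ) B]; rfl
    rw [this]
    simp
  refine ⟨φ, ?_, ?_⟩
  · ext i
    have := key (Polynomial.C (X i))
    rw [Polynomial.aeval_C] at this
    simpa [pr, ψ] using this
  · have := key Polynomial.X
    simpa [ψ] using this

end points
end BW
end

section
open scoped Topology
namespace BW

lemma norm_prod_ge (s : Multiset ℂ) (m : ℝ) (hm : 0 ≤ m) (h : ∀ τ ∈ s, m ≤ ‖τ‖) :
    m ^ (Multiset.card s) ≤ ‖s.prod‖ := by
  induction s using Multiset.induction_on with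
  | empty => simp
  | cons a s ih =>
    rw [Multiset.card_cons, Multiset.prod_cons, norm_mul, pow_succ, mul_comm]
    exact mul_le_mul (h a (Multiset.mem_cons_self _ _))
      (ih fun τ hτ => h τ (Multiset.mem_cons_of_mem hτ)) (by positivity) (norm_nonneg _)

lemma small_root (Q : Polynomial ℂ) (hQ : Q.Monic) (hd : 0 < Q.natDegree) :
    ∃ τ, Q.eval τ = 0 ∧ ‖τ‖ ^ Q.natDegree ≤ ‖Q.coeff 0‖ := by
  have hs := IsAlgClosed.splits Q
  have hc := hs.coeff_zero_eq_prod_roots_of_monic hQ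
  have hcard := hs.natDegree_eq_card_roots
  have hne : Q.roots.toFinset.Nonempty := by
    rw [Multiset.toFinset_nonempty, ← Multiset.card_pos]; omega
  obtain ⟨τ, hτ, hmin⟩ := Q.roots.toFinset.exists_min_image (fun t => ‖t‖) hne
  rw [Multiset.mem_toFinset, Polynomial.mem_roots hQ.ne_zero] at hτ
  refine ⟨τ, hτ, ?_⟩
  rw [hc, norm_mul, norm_pow, norm_neg, norm_one, one_pow, one_mul, hcard]
  exact norm_prod_ge _ _ (norm_nonneg _) fun σ hσ => hmin σ (Multiset.mem_toFinset.2 hσ)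

lemma deg_bdd {k : ℕ} {ι : Type*} [Finite ι] (p : ι → MvPolynomial (Fin k) ℂ) :
    ∃ s : ℕ, ∀ i, (p i).totalDegree ≤ s := by
  obtain ⟨s, hs⟩ := (Set.finite_range fun i => (p i).totalDegree).bddAbove
  exact ⟨s, fun i => hs ⟨i, rfl⟩⟩

set_option linter.unusedSectionVars false
section points
variable {k : ℕ} {B : Type*} [CommRing B] [IsDomain B] [Algebra ℂ B]
  [Algebra (MvPolynomial (Fin k) ℂ) B] [IsScalarTower ℂ (MvPolynomial (Fin k) ℂ) B]
  [Module.Finite (MvPolynomial (Fin k) ℂ) B] [FaithfulSMul (MvPolynomial (Fin k) ℂ) B]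

lemma fibre_finite (x : Fin k → ℂ) : {φ : B →ₐ[ℂ] ℂ | pr φ = x}.Finite := by
  obtain ⟨r, e, he⟩ := Module.Finite.exists_fin (R := MvPolynomial (Fin k) ℂ) (M := B)
  have hfin : (Set.pi Set.univ fun l : Fin r =>
      {τ : ℂ | ((minpoly (MvPolynomial (Fin k) ℂ) (e l)).map (eval x)).IsRoot τ}).Finite := by
    refine Set.Finite.pi fun l => Polynomial.finite_setOfPred_isRoot ?_
    exact ((minpoly.monic (Algebra.IsIntegral.isIntegral (e l))).map _).ne_zero
  refine Set.Finite.of_injOn (f := fun φ : B →ₐ[ℂ] ℂ => fun l => φ (e l)) ?_ ?_ hfin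
  · intro φ hφ l _
    have hφ' : pr φ = x := hφ
    have := minpoly_pr (k := k) φ (e l)
    rw [hφ'] at this
    exact this
  · intro φ hφ ψ hψ h
    have hφ' : pr φ = x := hφ
    have hψ' : pr ψ = x := hψ
    ext b
    have hb : b ∈ Submodule.span (MvPolynomial (Fin k) ℂ) (Set.range e) := by rw [he]; trivial
    obtain ⟨c, rfl⟩ := (Submodule.mem_span_range_iff_exists_fun _).1 hb
    simp only [map_sum, Algebra.smul_def, map_mul]
    refine Finset.sum_congr rfl fun l _ => ?_
    rw [← eval_pr, ← eval_pr, hφ', hψ']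
    exact congrArg _ (congrFun h l)

lemma separating (a : B →ₐ[ℂ] ℂ) :
    ∃ u : B, a u = 0 ∧ ∀ φ : B →ₐ[ℂ] ℂ, pr (k := k) φ = pr a → φ u = 0 → φ = a := by
  classical
  have hfin := fibre_finite (k := k) (B := B) (pr a)
  by_contra hcon
  push Not at hcon
  have hsub : ((RingHom.ker (a : B →+* ℂ) : Ideal B) : Set B) ⊆
      ⋃ φ ∈ ((hfin.toFinset.erase a : Finset (B →ₐ[ℂ] ℂ)) : Set (B →ₐ[ℂ] ℂ)),
        ((RingHom.ker (φ : B →+* ℂ) : Ideal B) : Set B) := by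
    intro u hu
    obtain ⟨φ, h1, h2, h3⟩ := hcon u hu
    simp only [Set.mem_iUnion]
    refine ⟨φ, ?_, h2⟩
    simp only [Finset.coe_erase, Set.Finite.coe_toFinset, Set.mem_sdiff, Set.mem_singleton_iff]
    exact ⟨h1, h3⟩
  rw [Ideal.subset_union_prime a a (fun φ _ _ _ => RingHom.ker_isPrime _)] at hsub
  obtain ⟨φ, hφ, hle⟩ := hsub
  have : a = φ := hom_eq_of_ker a φ fun b hb => hle hb
  rw [Finset.mem_erase] at hφ
  exact hφ.1 this.symm

lemma dense_point {N : ℕ} (z : Fin N → B) (Δ : MvPolynomial (Fin k) ℂ) (hΔ : Δ ≠ 0)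
    (a : B →ₐ[ℂ] ℂ) (δ : ℝ) (hδ : 0 < δ) :
    ∃ φ : B →ₐ[ℂ] ℂ, eval (pr φ) Δ ≠ 0 ∧ ∀ i, ‖φ (z i) - a (z i)‖ < δ := by
  obtain ⟨u, hu0, hu⟩ := separating (k := k) a
  have hIntg : ∀ b : B, IsIntegral (MvPolynomial (Fin k) ℂ) b := fun b => Algebra.IsIntegral.isIntegral b
  set μ := minpoly (MvPolynomial (Fin k) ℂ) u with hμ
  have hμm : μ.Monic := minpoly.monic (hIntg u)
  have hμd : 0 < μ.natDegree := minpoly.natDegree_pos (hIntg u)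
  have hroot : ∀ x, ∃ φ : B →ₐ[ℂ] ℂ, pr φ = x ∧ ‖φ u‖ ^ μ.natDegree ≤ ‖eval x (μ.coeff 0)‖ := by
    intro x
    have hd := hμm.natDegree_map (eval x)
    obtain ⟨τ, h1, h2⟩ := small_root (μ.map (eval x)) (hμm.map _) (by rw [hd]; exact hμd)
    obtain ⟨φ, h3, h4⟩ := lift_point u x τ h1
    refine ⟨φ, h3, ?_⟩
    rw [hd, Polynomial.coeff_map] at h2
    rw [h4]; exact h2
  choose Φ hΦ1 hΦ2 using hroot
  set x0 := pr (k := k) a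
  have hne : (𝓝[{x | eval x Δ ≠ 0}] x0).NeBot := by
    rw [nhdsWithin, ← Filter.frequently_mem_iff_neBot]
    intro h
    apply hΔ
    apply vanish_ball Δ x0
    filter_upwards [h] with x hx
    by_contra h'
    exact hx h'
  set U := Ultrafilter.of (𝓝[{x | eval x Δ ≠ 0}] x0)
  have hU : (U : Filter (Fin k → ℂ)) ≤ 𝓝[{x | eval x Δ ≠ 0}] x0 := Ultrafilter.of_le _
  have hU1 : (U : Filter (Fin k → ℂ)) ≤ 𝓝 x0 := hU.trans nhdsWithin_le_nhds
  have hlim : ∀ b : B, ∃ w, Tendsto (fun x => Φ x b) U (𝓝 w) := by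
    intro b
    obtain ⟨T, -, hT⟩ := root_bound_ball (minpoly (MvPolynomial (Fin k) ℂ) b) (minpoly.monic (hIntg b)) (‖x0‖ + 1)
    have hev : ∀ᶠ x in (U : Filter (Fin k → ℂ)), Φ x b ∈ closedBall (0:ℂ) T := by
      filter_upwards [hU1 (ball_mem_nhds x0 one_pos)] with x hx
      rw [mem_ball, dist_eq_norm] at hx
      have h1 := norm_sub_norm_le x x0
      have h2 := minpoly_pr (k := k) (Φ x) b
      rw [hΦ1] at h2
      simpa using hT x (by linarith) _ h2
    obtain ⟨w, -, hw⟩ := (isCompact_closedBall (0:ℂ) T).ultrafilter_le_nhds (U.map fun x => Φ x b)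
      (by rw [Ultrafilter.coe_map, le_principal_iff]; exact hev)
    exact ⟨w, hw⟩
  choose w hw using hlim
  let ψ : B →ₐ[ℂ] ℂ :=
    { toFun := w
      map_one' := tendsto_nhds_unique (hw 1) (by simp)
      map_zero' := tendsto_nhds_unique (hw 0) (by simp)
      map_mul' := fun b c => tendsto_nhds_unique (hw (b * c)) (by simpa using (hw b).mul (hw c))
      map_add' := fun b c => tendsto_nhds_unique (hw (b + c)) (by simpa using (hw b).add (hw c))
      commutes' := fun c => tendsto_nhds_unique (hw _) (by simp) }
  have hψ : ∀ b, ψ b = w b := fun b => rfl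
  have hpr : pr (k := k) ψ = x0 := by
    ext i
    refine tendsto_nhds_unique (hw (algebraMap _ B (X i))) ?_
    have h1 : ∀ x, Φ x (algebraMap (MvPolynomial (Fin k) ℂ) B (X i)) = x i := fun x =>
      congrFun (hΦ1 x) i
    simp only [h1]
    exact ((continuous_apply i).tendsto x0).mono_left hU1
  have hψu : ψ u = 0 := by
    have h1 : Tendsto (fun x => ‖Φ x u‖ ^ μ.natDegree) U (𝓝 (‖w u‖ ^ μ.natDegree)) :=
      ((hw u).norm).pow _
    have h2 : Tendsto (fun x => ‖eval x (μ.coeff 0)‖) U (𝓝 ‖eval x0 (μ.coeff 0)‖) :=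
      (((continuous_eval' (μ.coeff 0)).norm).tendsto x0).mono_left hU1
    have h3 := le_of_tendsto_of_tendsto' h1 h2 hΦ2
    have h4 : eval x0 (μ.coeff 0) = 0 := by
      have := minpoly_pr (k := k) a u
      rw [hu0, ← Polynomial.coeff_zero_eq_eval_zero, Polynomial.coeff_map] at this
      exact this
    rw [h4, norm_zero] at h3
    have h5 : ‖w u‖ ^ μ.natDegree = 0 := le_antisymm h3 (by positivity)
    exact norm_eq_zero.1 (pow_eq_zero_iff hμd.ne' |>.1 h5)
  have hψa : ψ = a := hu ψ hpr hψu
  have hev : ∀ᶠ x in (U : Filter (Fin k → ℂ)), ∀ i, ‖Φ x (z i) - a (z i)‖ < δ := by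
    rw [eventually_all]
    intro i
    have := hw (z i)
    rw [← hψ, hψa, Metric.tendsto_nhds] at this
    simpa [dist_eq_norm] using this δ hδ
  have hev2 : ∀ᶠ x in (U : Filter (Fin k → ℂ)), eval x Δ ≠ 0 := hU self_mem_nhdsWithin
  obtain ⟨x, h1, h2⟩ := (hev.and hev2).exists
  exact ⟨Φ x, by rw [hΦ1]; exact h2, h1⟩

/-- The elements with a representation of bounded degree. -/
def WW {r : ℕ} (e : Fin r → B) (D : ℕ) : Set B :=
  {b | ∃ c : Fin r → MvPolynomial (Fin k) ℂ, (∀ l, (c l).totalDegree ≤ D) ∧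
    b = ∑ l, algebraMap (MvPolynomial (Fin k) ℂ) B (c l) * e l}

lemma degree_control {N : ℕ} (z : Fin N → B) {r : ℕ} (e : Fin r → B)
    (he : Submodule.span (MvPolynomial (Fin k) ℂ) (Set.range e) = ⊤) :
    ∃ s : ℕ, ∀ (n : ℕ) (q : MvPolynomial (Fin N) ℂ), q.totalDegree ≤ n →
      aeval z q ∈ WW (k := k) e (s * (n + 1)) := by
  have hrep : ∀ b : B, ∃ c : Fin r → MvPolynomial (Fin k) ℂ,
      b = ∑ l, algebraMap (MvPolynomial (Fin k) ℂ) B (c l) * e l := by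
    intro b
    have hb : b ∈ Submodule.span (MvPolynomial (Fin k) ℂ) (Set.range e) := by rw [he]; trivial
    obtain ⟨c, hc⟩ := (Submodule.mem_span_range_iff_exists_fun _).1 hb
    exact ⟨c, by rw [← hc]; simp [Algebra.smul_def]⟩
  choose c hc using hrep
  obtain ⟨s1, hs1⟩ := deg_bdd fun p : Fin N × Fin r × Fin r => c (z p.1 * e p.2.1) p.2.2
  obtain ⟨s2, hs2⟩ := deg_bdd fun l => c 1 l
  set s := max s1 s2
  have hmono : ∀ D D' : ℕ, D ≤ D' → ∀ b ∈ WW (k := k) e D, b ∈ WW (k := k) e D' := by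
    rintro D D' h b ⟨c, h1, h2⟩
    exact ⟨c, fun l => (h1 l).trans h, h2⟩
  have hz : ∀ D, ∀ b ∈ WW (k := k) e D, ∀ i, b * z i ∈ WW (k := k) e (D + s) := by
    rintro D b ⟨d, h1, h2⟩ i
    refine ⟨fun l' => ∑ l, d l * c (z i * e l) l', fun l' => ?_, ?_⟩
    · refine MvPolynomial.totalDegree_finsetSum_le fun l _ => ?_
      refine (MvPolynomial.totalDegree_mul _ _).trans (add_le_add (h1 l) ?_)
      exact (hs1 (i, l, l')).trans (le_max_left _ _)
    · rw [h2, Finset.sum_mul]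
      simp only [map_sum, map_mul, Finset.sum_mul]
      rw [Finset.sum_comm]
      refine Finset.sum_congr rfl fun l _ => ?_
      have := hc (z i * e l)
      calc _ = algebraMap (MvPolynomial (Fin k) ℂ) B (d l) * (z i * e l) := by ring
        _ = _ := by
          rw [this, Finset.mul_sum, ← this]
          exact Finset.sum_congr rfl fun l' _ => by ring
  have hone : (1 : B) ∈ WW (k := k) e s := ⟨c 1, fun l => (hs2 l).trans (le_max_right _ _), hc 1⟩
  have hmon : ∀ (d : Fin N → ℕ) (t : Finset (Fin N)),
      ∏ i ∈ t, z i ^ d i ∈ WW (k := k) e (s * (∑ i ∈ t, d i + 1)) := by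
    classical
    intro d t
    induction t using Finset.induction_on with
    | empty => simpa using hone
    | insert i t hi ih =>
      rw [Finset.prod_insert hi, Finset.sum_insert hi]
      generalize d i = m
      induction m with
      | zero => simpa using ih
      | succ m ihm =>
        have := hz _ _ ihm i
        rw [pow_succ, mul_right_comm]
        convert this using 2
        ring
  refine ⟨s, fun n q hq => ?_⟩
  rw [MvPolynomial.aeval_def, MvPolynomial.eval₂_eq']
  have hterm : ∀ m ∈ q.support, algebraMap ℂ B (coeff m q) * ∏ i, z i ^ m i
      ∈ WW (k := k) e (s * (n + 1)) := by
    intro m hm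
    have hdeg : ∑ i, m i ≤ n := by
      have := MvPolynomial.le_totalDegree hm
      rw [Finsupp.sum_fintype _ _ (fun _ => rfl)] at this
      exact this.trans hq
    obtain ⟨c', h1, h2⟩ := hmono _ (s * (n + 1)) (by gcongr) _ (hmon m Finset.univ)
    refine ⟨fun l => C (coeff m q) * c' l, fun l => ?_, ?_⟩
    · refine (MvPolynomial.totalDegree_mul _ _).trans ?_
      rw [MvPolynomial.totalDegree_C, zero_add]; exact h1 l
    · rw [h2, Finset.mul_sum]
      refine Finset.sum_congr rfl fun l _ => ?_
      rw [map_mul, IsScalarTower.algebraMap_apply ℂ (MvPolynomial (Fin k) ℂ) B,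
        MvPolynomial.algebraMap_eq, mul_assoc]
  classical
  generalize q.support = t at hterm
  induction t using Finset.induction_on with
  | empty => exact ⟨0, by simp, by simp⟩
  | insert m t hm ih =>
    rw [Finset.sum_insert hm]
    obtain ⟨c1, h1, h2⟩ := hterm m (Finset.mem_insert_self _ _)
    obtain ⟨c2, h3, h4⟩ := ih fun m' hm' => hterm m' (Finset.mem_insert_of_mem hm')
    refine ⟨c1 + c2, fun l => ?_, ?_⟩
    · exact (MvPolynomial.totalDegree_add _ _).trans (max_le (h1 l) (h3 l))
    · rw [h2, h4, ← Finset.sum_add_distrib]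
      exact Finset.sum_congr rfl fun l _ => by simp [add_mul]

lemma fval_control {N : ℕ} (z : Fin N → B) (θ : B) (Δ : MvPolynomial (Fin k) ℂ)
    (h : ∀ b : B, ∃ f : Polynomial (MvPolynomial (Fin k) ℂ),
      f.natDegree < (minpoly (MvPolynomial (Fin k) ℂ) θ).natDegree ∧
        algebraMap (MvPolynomial (Fin k) ℂ) B Δ * b = Polynomial.aeval θ f) :
    ∃ s : ℕ, 1 ≤ s ∧ ∀ (n : ℕ) (q : MvPolynomial (Fin N) ℂ), q.totalDegree ≤ n →
      ∃ c : Fin (minpoly (MvPolynomial (Fin k) ℂ) θ).natDegree → MvPolynomial (Fin k) ℂ,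
        (∀ j, (c j).totalDegree ≤ s * (n + 1)) ∧
        ∀ φ : B →ₐ[ℂ] ℂ, eval (pr φ) Δ * φ (aeval z q) = Fval c (pr φ) (φ θ) := by
  obtain ⟨r, e, he⟩ := Module.Finite.exists_fin (R := MvPolynomial (Fin k) ℂ) (M := B)
  obtain ⟨s, hs⟩ := degree_control z e he
  choose f hf1 hf2 using h
  obtain ⟨s2, hs2⟩ := deg_bdd fun p : Fin r × Fin (minpoly (MvPolynomial (Fin k) ℂ) θ).natDegree =>
    (f (e p.1)).coeff (p.2 : ℕ)
  refine ⟨s + s2 + 1, by omega, fun n q hq => ?_⟩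
  obtain ⟨d, hd1, hd2⟩ := hs n q hq
  refine ⟨fun j => ∑ l, d l * (f (e l)).coeff (j : ℕ), fun j => ?_, fun φ => ?_⟩
  · refine MvPolynomial.totalDegree_finsetSum_le fun l _ => ?_
    refine (MvPolynomial.totalDegree_mul _ _).trans ((add_le_add (hd1 l) (hs2 (l, j))).trans ?_)
    nlinarith
  · rw [eval_pr, ← map_mul, hd2, Finset.mul_sum, map_sum]
    unfold Fval
    simp only [map_sum, map_mul, Finset.sum_mul]
    rw [Finset.sum_comm]
    refine Finset.sum_congr rfl fun l _ => ?_
    have h1 : φ (algebraMap (MvPolynomial (Fin k) ℂ) B Δ) * φ (e l) =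
        ∑ j : Fin (minpoly (MvPolynomial (Fin k) ℂ) θ).natDegree,
          eval (pr φ) ((f (e l)).coeff (j : ℕ)) * φ θ ^ (j : ℕ) := by
      rw [← map_mul, hf2, Polynomial.aeval_eq_sum_range' (hf1 (e l)), map_sum, Finset.sum_range]
      refine Finset.sum_congr rfl fun j _ => ?_
      rw [Algebra.smul_def, map_mul, map_pow, eval_pr]
    rw [← eval_pr (p := d l), mul_left_comm, h1, Finset.mul_sum]
    exact Finset.sum_congr rfl fun j _ => by ring
end points
end BW
end

section
open scoped Topology
namespace BW

lemma power_trick (a K x y : ℝ) (ha : 0 < a) (hy : 0 < y)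
    (h : ∀ l : ℕ, 1 ≤ l → a * x ^ l ≤ K * y ^ l) : x ≤ y := by
  by_contra hxy
  push Not at hxy
  have h1 : 1 < x / y := (one_lt_div hy).2 hxy
  have h2 := (tendsto_pow_atTop_atTop_of_one_lt h1).eventually_gt_atTop (K / a)
  obtain ⟨l, hl1, hl2⟩ := (h2.and (eventually_ge_atTop 1)).exists
  have h3 := h l hl2
  rw [div_pow, div_lt_div_iff₀ ha (by positivity)] at hl1
  linarith [mul_comm a (x ^ l)]

lemma hom_aeval {N : ℕ} {B : Type*} [CommRing B] [Algebra ℂ B] (φ : B →ₐ[ℂ] ℂ)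
    (z : Fin N → B) (q : MvPolynomial (Fin N) ℂ) :
    φ (aeval z q) = eval (fun i => φ (z i)) q := by
  have : φ.comp (aeval z) = aeval (fun i => φ (z i)) := by
    apply MvPolynomial.algHom_ext; intro i; simp
  have h := congrArg (fun g => g q) this
  simpa [MvPolynomial.aeval_eq_eval] using h

lemma continuous_Fval {k m : ℕ} (c : Fin m → MvPolynomial (Fin k) ℂ) :
    Continuous fun p : (Fin k → ℂ) × ℂ => Fval c p.1 p.2 := by
  unfold Fval
  refine continuous_finsetSum _ fun j _ => ?_
  exact ((continuous_eval' (c j)).comp continuous_fst).mul (continuous_snd.pow _)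

lemma near_aux {k m N : ℕ} (Δ : MvPolynomial (Fin k) ℂ)
    (co : Fin N → Fin m → MvPolynomial (Fin k) ℂ) (a : Fin N → ℂ) (δ : ℝ) (x0 : Fin k → ℂ)
    (τ0 : ℂ) (h0 : eval x0 Δ ≠ 0) (h : ∀ i, ‖Fval (co i) x0 τ0 / eval x0 Δ - a i‖ < δ) :
    ∀ᶠ p : (Fin k → ℂ) × ℂ in 𝓝 (x0, τ0), eval p.1 Δ ≠ 0 ∧
      ∀ i, ‖Fval (co i) p.1 p.2 / eval p.1 Δ - a i‖ < δ := by
  have hDc : Continuous fun p : (Fin k → ℂ) × ℂ => eval p.1 Δ :=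
    (continuous_eval' Δ).comp continuous_fst
  have h1 : ∀ᶠ p : (Fin k → ℂ) × ℂ in 𝓝 (x0, τ0), eval p.1 Δ ≠ 0 :=
    (hDc.tendsto (x0, τ0)).eventually_ne h0
  refine h1.and ?_
  rw [eventually_all]
  intro i
  have hcont : Tendsto (fun p : (Fin k → ℂ) × ℂ =>
      ‖Fval (co i) p.1 p.2 / eval p.1 Δ - a i‖) (𝓝 (x0, τ0))
      (𝓝 ‖Fval (co i) x0 τ0 / eval x0 Δ - a i‖) :=
    ((((continuous_Fval (co i)).tendsto (x0, τ0)).div (hDc.tendsto (x0, τ0)) h0).sub_const _).norm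
  exact hcont.eventually_lt_const (h i)

section points
variable {k : ℕ} {B : Type*} [CommRing B] [IsDomain B] [Algebra ℂ B]
  [Algebra (MvPolynomial (Fin k) ℂ) B] [IsScalarTower ℂ (MvPolynomial (Fin k) ℂ) B]
  [Module.Finite (MvPolynomial (Fin k) ℂ) B] [FaithfulSMul (MvPolynomial (Fin k) ℂ) B]

lemma thmL_points {N : ℕ} (z : Fin N → B) (hz : Algebra.adjoin ℂ (range z) = ⊤)
    (a : B →ₐ[ℂ] ℂ) (δ : ℝ) (hδ : 0 < δ) (R : ℝ) (_hk : 0 ≤ k) :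
    ∃ C : ℝ, 1 ≤ C ∧ ∀ n : ℕ, 1 ≤ n → ∀ q : MvPolynomial (Fin N) ℂ, q.totalDegree ≤ n →
      (∀ φ : B →ₐ[ℂ] ℂ, (∀ i, ‖φ (z i) - a (z i)‖ < δ) → ‖φ (aeval z q)‖ ≤ 1) →
      ∀ φ : B →ₐ[ℂ] ℂ, (∀ i, ‖φ (z i)‖ ≤ R) → ‖φ (aeval z q)‖ ≤ C ^ n := by
  obtain ⟨θ, Δ, hΔ, hrep, U, V, hUV⟩ := primitive (A := MvPolynomial (Fin k) ℂ) (B := B)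
  have hIntg : IsIntegral (MvPolynomial (Fin k) ℂ) θ := Algebra.IsIntegral.isIntegral θ
  obtain ⟨s, hs1, hs⟩ := fval_control z θ Δ hrep
  obtain ⟨φ0, hφ0, hφa⟩ := dense_point z Δ hΔ a δ hδ
  have hsep : ∀ x, eval x Δ ≠ 0 →
      ((minpoly (MvPolynomial (Fin k) ℂ) θ).map (eval x)).Separable := by
    intro x hx
    have h := congrArg (Polynomial.map (eval x)) hUV
    simp only [Polynomial.map_add, Polynomial.map_mul, Polynomial.map_C] at h
    refine ⟨Polynomial.C (eval x Δ)⁻¹ * U.map (eval x), Polynomial.C (eval x Δ)⁻¹ * V.map (eval x), ?_⟩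
    rw [Polynomial.derivative_map, mul_assoc, mul_assoc, ← mul_add, h, ← Polynomial.C_mul,
      inv_mul_cancel₀ hx, Polynomial.C_1]
  -- coefficient representation of the coordinates
  have hco : ∀ i, ∃ c : Fin (minpoly (MvPolynomial (Fin k) ℂ) θ).natDegree → MvPolynomial (Fin k) ℂ,
      ∀ φ : B →ₐ[ℂ] ℂ, eval (pr φ) Δ * φ (z i) = Fval c (pr φ) (φ θ) := by
    intro i
    obtain ⟨c, -, hc⟩ := hs _ (X i) le_rfl
    refine ⟨c, fun φ => ?_⟩
    simpa using hc φ
  choose co hco using hco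
  have hnear := near_aux Δ co (fun i => a (z i)) δ (pr φ0) (φ0 θ) hφ0 (fun i => by
    rw [← hco, mul_div_cancel_left₀ _ hφ0]
    exact hφa i)
  obtain ⟨r, hr, hball⟩ := Metric.eventually_nhds_iff_ball.1 hnear
  rw [← ball_prod_same] at hball
  have hlift : ∀ x ∈ ball (pr (k := k) φ0) r, ∀ τ ∈ ball (φ0 θ) r,
      ((minpoly (MvPolynomial (Fin k) ℂ) θ).map (eval x)).eval τ = 0 →
      ∃ φ : B →ₐ[ℂ] ℂ, pr φ = x ∧ φ θ = τ ∧ ∀ i, ‖φ (z i) - a (z i)‖ < δ := by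
    intro x hx τ hτ hroot
    obtain ⟨φ, rfl, rfl⟩ := lift_point θ x τ hroot
    obtain ⟨h1, h2⟩ := hball (pr φ, φ θ) ⟨hx, hτ⟩
    refine ⟨φ, rfl, rfl, fun i => ?_⟩
    have := h2 i
    dsimp only at this h1
    rwa [← hco, mul_div_cancel_left₀ _ h1] at this
  obtain ⟨D0, hD0, hDb⟩ := eval_bounded Δ (‖pr (k := k) φ0‖ + r)
  set D := D0 + 1 with hD
  have hDpos : 0 < D := by positivity
  have hDb' : ∀ x ∈ ball (pr (k := k) φ0) r, ‖eval x Δ‖ ≤ D := by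
    intro x hx
    rw [mem_ball, dist_eq_norm] at hx
    have h1 := norm_sub_norm_le x (pr (k := k) φ0)
    have := hDb x (by linarith)
    linarith
  -- bound for the base points
  have hgen : ∀ b : B, ∃ p : MvPolynomial (Fin N) ℂ, aeval z p = b := by
    intro b
    have hb : b ∈ Algebra.adjoin ℂ (range z) := by rw [hz]; trivial
    rw [Algebra.adjoin_range_eq_range_aeval] at hb
    exact hb
  choose gen hgen using hgen
  have hR' : ∃ R' : ℝ, ∀ φ : B →ₐ[ℂ] ℂ, (∀ i, ‖φ (z i)‖ ≤ |R| + 1) → ‖pr (k := k) φ‖ ≤ R' := by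
    have hb : ∀ i : Fin k, ∃ C, 0 ≤ C ∧ ∀ φ : B →ₐ[ℂ] ℂ, (∀ i, ‖φ (z i)‖ ≤ |R| + 1) →
        ‖pr (k := k) φ i‖ ≤ C := by
      intro i
      obtain ⟨C, hC0, hC⟩ := eval_bounded (gen (algebraMap (MvPolynomial (Fin k) ℂ) B (X i))) (|R| + 1)
      refine ⟨C, hC0, fun φ hφ => ?_⟩
      have h1 : pr (k := k) φ i = eval (fun i => φ (z i)) (gen (algebraMap (MvPolynomial (Fin k) ℂ) B (X i))) := by
        rw [← hom_aeval, hgen]; rfl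
      rw [h1]
      exact hC _ ((pi_norm_le_iff_of_nonneg (by positivity)).2 hφ)
    choose C hC0 hC using hb
    refine ⟨∑ i, C i, fun φ hφ => ?_⟩
    refine (pi_norm_le_iff_of_nonneg (Finset.sum_nonneg fun i _ => hC0 i)).2 fun i => ?_
    exact (hC i φ hφ).trans (Finset.single_le_sum (fun i _ => hC0 i) (Finset.mem_univ i))
  obtain ⟨R', hR'⟩ := hR'
  obtain ⟨C1, hC1, hH⟩ := thmH (minpoly (MvPolynomial (Fin k) ℂ) θ) (minpoly.monic hIntg)
    (minpoly.irreducible hIntg) Δ hsep (pr φ0) (φ0 θ) r hr hφ0 (minpoly_pr φ0 θ) R'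
  refine ⟨C1 ^ s, one_le_pow₀ hC1, fun n hn q hq hsmall => ?_⟩
  have hgood : ∀ φ : B →ₐ[ℂ] ℂ, eval (pr (k := k) φ) Δ ≠ 0 → (∀ i, ‖φ (z i)‖ ≤ |R| + 1) →
      ‖φ (aeval z q)‖ ≤ (C1 ^ s) ^ n := by
    intro φ hφ hφR
    refine power_trick ‖eval (pr (k := k) φ) Δ‖ (D * C1 ^ s) _ _ (norm_pos_iff.2 hφ)
      (by positivity) fun l hl => ?_
    obtain ⟨c, hc1, hc2⟩ := hs (l * n) (q ^ l)
      ((MvPolynomial.totalDegree_pow _ _).trans (Nat.mul_le_mul_left _ hq))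
    have hFs : ∀ x τ, Fval (fun j => C ((D : ℂ)⁻¹) * c j) x τ = (D : ℂ)⁻¹ * Fval c x τ := by
      intro x τ
      unfold Fval
      rw [Finset.mul_sum]
      refine Finset.sum_congr rfl fun j _ => ?_
      rw [map_mul, eval_C, mul_assoc]
    have hDn : ‖(D : ℂ)⁻¹‖ = D⁻¹ := by
      rw [norm_inv, Complex.norm_real, Real.norm_of_nonneg hDpos.le]
    have h := hH (s * (l * n + 1)) (Nat.mul_pos hs1 (Nat.succ_pos _))
      (fun j => C ((D : ℂ)⁻¹) * c j) (fun j => by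
        refine (MvPolynomial.totalDegree_mul _ _).trans ?_
        rw [MvPolynomial.totalDegree_C, zero_add]; exact hc1 j)
      (by
        intro x hx τ hτ hroot
        obtain ⟨ψ, rfl, rfl, hψ⟩ := hlift x hx τ hτ hroot
        rw [hFs, norm_mul, hDn, ← hc2, norm_mul, map_pow, map_pow, norm_pow]
        have h1 := hDb' _ hx
        have h2 : ‖ψ (aeval z q)‖ ^ l ≤ 1 := pow_le_one₀ (norm_nonneg _) (hsmall ψ hψ)
        calc D⁻¹ * (‖eval (pr ψ) Δ‖ * ‖ψ (aeval z q)‖ ^ l) ≤ D⁻¹ * (D * 1) := by gcongr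
          _ = 1 := by field_simp)
      (pr φ) (hR' φ hφR) (φ θ) (minpoly_pr φ θ)
    rw [hFs, norm_mul, hDn, ← hc2, norm_mul, map_pow, map_pow, norm_pow, inv_mul_le_iff₀ hDpos] at h
    refine h.trans (le_of_eq ?_)
    rw [mul_assoc D, ← pow_mul, ← pow_mul, ← pow_add]
    congr 2; ring
  intro φ hφ
  by_contra hcon
  push Not at hcon
  rw [hom_aeval] at hcon
  have hev : ∀ᶠ x in 𝓝 (fun i => φ (z i)), (C1 ^ s) ^ n < ‖eval x q‖ :=
    (continuous_const.tendsto _).eventually_lt ((continuous_eval' q).norm.tendsto _) hcon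
  obtain ⟨ε, hε, hεb⟩ := Metric.eventually_nhds_iff_ball.1 hev
  obtain ⟨ψ, hψ1, hψ2⟩ := dense_point z Δ hΔ φ (min ε 1) (by positivity)
  have h1 := hgood ψ hψ1 (fun i => by
    have h2 := norm_sub_norm_le (ψ (z i)) (φ (z i))
    have h3 := (hψ2 i).trans_le (min_le_right _ _)
    linarith [hφ i, le_abs_self R])
  have h4 := hεb (fun i => ψ (z i)) (by
    rw [mem_ball, dist_pi_lt_iff hε]
    intro i
    rw [dist_eq_norm]
    exact (hψ2 i).trans_le (min_le_left _ _))
  rw [← hom_aeval] at h4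
  linarith
end points

theorem thmL {N : ℕ} {B : Type*} [CommRing B] [IsDomain B] [Algebra ℂ B] (z : Fin N → B)
    (hz : Algebra.adjoin ℂ (range z) = ⊤)
    (a : B →ₐ[ℂ] ℂ) (δ : ℝ) (hδ : 0 < δ) (R : ℝ) :
    ∃ C : ℝ, 1 ≤ C ∧ ∀ n : ℕ, 1 ≤ n → ∀ q : MvPolynomial (Fin N) ℂ, q.totalDegree ≤ n →
      (∀ φ : B →ₐ[ℂ] ℂ, (∀ i, ‖φ (z i) - a (z i)‖ < δ) → ‖φ (aeval z q)‖ ≤ 1) →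
      ∀ φ : B →ₐ[ℂ] ℂ, (∀ i, ‖φ (z i)‖ ≤ R) → ‖φ (aeval z q)‖ ≤ C ^ n := by
  classical
  have : Algebra.FiniteType ℂ B := ⟨⟨Finset.univ.image z, by simpa using hz⟩⟩
  obtain ⟨s, g, hg1, hg2⟩ := exists_finite_inj_algHom_of_fg ℂ B
  let : Algebra (MvPolynomial (Fin s) ℂ) B := g.toRingHom.toAlgebra
  have hmap : ∀ p, algebraMap (MvPolynomial (Fin s) ℂ) B p = g p := fun p => rfl
  have : IsScalarTower ℂ (MvPolynomial (Fin s) ℂ) B := IsScalarTower.of_algebraMap_eq fun c => by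
    rw [hmap]; exact (g.commutes c).symm
  have : Module.Finite (MvPolynomial (Fin s) ℂ) B := hg2
  have hf : FaithfulSMul (MvPolynomial (Fin s) ℂ) B := (faithfulSMul_iff_algebraMap_injective _ _).2 hg1
  exact thmL_points (k := s) z hz a δ hδ R (Nat.zero_le s)
end BW
end

section
open scoped Topology
namespace BW

/-- Homogenization in degree `n`. -/
noncomputable def homog {N : ℕ} (n : ℕ) (q : MvPolynomial (Fin N) ℂ) : MvPolynomial (Fin (N + 1)) ℂ :=
  ∑ m ∈ q.support, C (coeff m q) * (X 0 ^ (n - ∑ i, m i) * ∏ i : Fin N, X i.succ ^ m i)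

lemma sum_le_of_mem {N : ℕ} {n : ℕ} {q : MvPolynomial (Fin N) ℂ} (hq : q.totalDegree ≤ n)
    {m : Fin N →₀ ℕ} (hm : m ∈ q.support) : ∑ i, m i ≤ n := by
  have := MvPolynomial.le_totalDegree hm
  rw [Finsupp.sum_fintype _ _ (fun _ => rfl)] at this
  exact this.trans hq

lemma homog_degree {N : ℕ} (n : ℕ) (q : MvPolynomial (Fin N) ℂ) (hq : q.totalDegree ≤ n) :
    (homog n q).totalDegree ≤ n := by
  refine MvPolynomial.totalDegree_finsetSum_le fun m hm => ?_
  have hs := sum_le_of_mem hq hm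
  refine (MvPolynomial.totalDegree_mul _ _).trans ?_
  rw [MvPolynomial.totalDegree_C, zero_add]
  refine (MvPolynomial.totalDegree_mul _ _).trans ?_
  have h1 : (X 0 ^ (n - ∑ i, m i) : MvPolynomial (Fin (N + 1)) ℂ).totalDegree ≤ n - ∑ i, m i := by
    rw [MvPolynomial.totalDegree_X_pow]
  have h2 : (∏ i : Fin N, X i.succ ^ m i : MvPolynomial (Fin (N + 1)) ℂ).totalDegree ≤ ∑ i, m i := by
    refine (MvPolynomial.totalDegree_finsetProd _ _).trans (Finset.sum_le_sum fun i _ => ?_)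
    rw [MvPolynomial.totalDegree_X_pow]
  omega

lemma homog_aeval {N : ℕ} {S : Type*} [CommRing S] [Algebra ℂ S] (n : ℕ)
    (q : MvPolynomial (Fin N) ℂ) (hq : q.totalDegree ≤ n) (T : S) (y : Fin N → S) :
    aeval (Fin.cons T (fun i => T * y i) : Fin (N + 1) → S) (homog n q) = T ^ n * aeval y q := by
  unfold homog
  rw [MvPolynomial.aeval_def y, MvPolynomial.eval₂_eq', map_sum, Finset.mul_sum]
  refine Finset.sum_congr rfl fun m hm => ?_
  have hs := sum_le_of_mem hq hm
  simp only [map_mul, map_pow, map_prod, aeval_X, aeval_C, Fin.cons_zero, Fin.cons_succ, mul_pow,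
    Finset.prod_mul_distrib, Finset.prod_pow_eq_pow_sum]
  have : T ^ n = T ^ (n - ∑ i, m i) * T ^ (∑ i, m i) := by rw [← pow_add]; congr 1; omega
  rw [this]; ring

lemma homog_eval {N : ℕ} (n : ℕ) (q : MvPolynomial (Fin N) ℂ) (hq : q.totalDegree ≤ n)
    (v : Fin (N + 1) → ℂ) (hv : v 0 ≠ 0) :
    eval v (homog n q) = v 0 ^ n * eval (fun i => v i.succ / v 0) q := by
  have h := homog_aeval n q hq (v 0) (fun i => v i.succ / v 0)
  have hv' : (Fin.cons (v 0) (fun i => v 0 * (v i.succ / v 0)) : Fin (N + 1) → ℂ) = v := by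
    ext j
    refine Fin.cases ?_ (fun i => ?_) j
    · simp
    · simp [mul_div_cancel₀, hv]
  rw [hv'] at h
  simpa [MvPolynomial.aeval_eq_eval] using h

lemma mem_vanish {N : ℕ} (A : Set (EuclideanSpace ℂ (Fin N))) (p : MvPolynomial (Fin N) ℂ) :
    p ∈ vanishIdeal A ↔ ∀ z ∈ A, evalAt z p = 0 := by
  unfold vanishIdeal evalAt
  rw [RingHom.mem_ker, funext_iff]
  exact ⟨fun h z hz => h ⟨z, hz⟩, fun h z => h z z.2⟩

section cone
variable {N : ℕ} (A : Set (EuclideanSpace ℂ (Fin N)))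

/-- The parametrization of the cone over `A`. -/
noncomputable def Psi : MvPolynomial (Fin (N + 1)) ℂ →ₐ[ℂ]
    Polynomial (MvPolynomial (Fin N) ℂ ⧸ vanishIdeal A) :=
  aeval (Fin.cons Polynomial.X (fun i => Polynomial.X *
    Polynomial.C (Ideal.Quotient.mk (vanishIdeal A) (X i))))

/-- The coordinate ring of the cone. -/
abbrev Cone : Type := MvPolynomial (Fin (N + 1)) ℂ ⧸ RingHom.ker (Psi A)

/-- The coordinates on the cone. -/
noncomputable def zc (j : Fin (N + 1)) : Cone A := Ideal.Quotient.mk (RingHom.ker (Psi A)) (X j)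

lemma aeval_zc (q : MvPolynomial (Fin (N + 1)) ℂ) :
    aeval (zc A) q = Ideal.Quotient.mk (RingHom.ker (Psi A)) q := by
  have : (aeval (zc A) : _ →ₐ[ℂ] _) = Ideal.Quotient.mkₐ ℂ (RingHom.ker (Psi A)) := by
    apply MvPolynomial.algHom_ext; intro i; rw [aeval_X]; rfl
  rw [this]; rfl

lemma adjoin_zc : Algebra.adjoin ℂ (range (zc A)) = ⊤ := by
  rw [Algebra.adjoin_range_eq_range_aeval, eq_top_iff]
  rintro x -
  obtain ⟨q, hq⟩ := Ideal.Quotient.mk_surjective x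
  exact ⟨q, (aeval_zc A q).trans hq⟩

/-- Points of the affine coordinate ring. -/
noncomputable def pt0 (z : EuclideanSpace ℂ (Fin N)) (hz : z ∈ A) :
    (MvPolynomial (Fin N) ℂ ⧸ vanishIdeal A) →ₐ[ℂ] ℂ :=
  Ideal.Quotient.liftₐ (vanishIdeal A) (aeval (fun i => z i))
    (fun p hp => by
      have := (mem_vanish A p).1 hp z hz
      simpa [evalAt, MvPolynomial.aeval_eq_eval] using this)

/-- Points of the cone. -/
noncomputable def pt (z : EuclideanSpace ℂ (Fin N)) (hz : z ∈ A) (τ : ℂ) : Cone A →ₐ[ℂ] ℂ :=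
  Ideal.Quotient.liftₐ (RingHom.ker (Psi A))
    ((Polynomial.eval₂AlgHom (pt0 A z hz) τ (fun _ => Commute.all _ _)).comp (Psi A))
    (fun p hp => by
      have : Psi A p = 0 := hp
      rw [AlgHom.comp_apply, this, map_zero])

lemma pt_zc (z : EuclideanSpace ℂ (Fin N)) (hz : z ∈ A) (τ : ℂ) (j : Fin (N + 1)) :
    pt A z hz τ (zc A j) =
      Polynomial.eval₂ (pt0 A z hz : (MvPolynomial (Fin N) ℂ ⧸ vanishIdeal A) →+* ℂ) τ
        (Psi A (X j)) := rfl

lemma pt0_X (z : EuclideanSpace ℂ (Fin N)) (hz : z ∈ A) (i : Fin N) :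
    pt0 A z hz (Ideal.Quotient.mk (vanishIdeal A) (X i)) = z i := by
  change aeval (fun i => z i) (X i) = z i
  simp

lemma pt_zero (z : EuclideanSpace ℂ (Fin N)) (hz : z ∈ A) (τ : ℂ) : pt A z hz τ (zc A 0) = τ := by
  rw [pt_zc]
  simp [Psi]

lemma pt_succ (z : EuclideanSpace ℂ (Fin N)) (hz : z ∈ A) (τ : ℂ) (i : Fin N) :
    pt A z hz τ (zc A i.succ) = τ * z i := by
  rw [pt_zc]
  simp [Psi, Polynomial.eval₂_mul, pt0_X, mul_comm]

lemma point_mem (halg : IsAlgebraicSet A) (φ : Cone A →ₐ[ℂ] ℂ) (h0 : φ (zc A 0) ≠ 0) :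
    WithLp.toLp 2 (fun i : Fin N => φ (zc A i.succ) / φ (zc A 0)) ∈ A := by
  obtain ⟨S, hS⟩ := halg
  have key : ∀ p ∈ vanishIdeal A, eval (fun i : Fin N => φ (zc A i.succ) / φ (zc A 0)) p = 0 := by
    intro p hp
    have h1 : Psi A (homog p.totalDegree p) = 0 := by
      unfold Psi
      refine (homog_aeval (S := Polynomial (MvPolynomial (Fin N) ℂ ⧸ vanishIdeal A)) _ _ le_rfl
        Polynomial.X (fun i => Polynomial.C (Ideal.Quotient.mk (vanishIdeal A) (X i)))).trans ?_
      have : (aeval (fun i => Polynomial.C (Ideal.Quotient.mk (vanishIdeal A) (X i))) :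
          MvPolynomial (Fin N) ℂ →ₐ[ℂ] Polynomial (MvPolynomial (Fin N) ℂ ⧸ vanishIdeal A)) =
          Polynomial.CAlgHom.comp (Ideal.Quotient.mkₐ ℂ (vanishIdeal A)) := by
        apply MvPolynomial.algHom_ext; intro i; simp
      rw [this]
      simp [Ideal.Quotient.eq_zero_iff_mem.2 hp]
    have h2 : Ideal.Quotient.mk (RingHom.ker (Psi A)) (homog p.totalDegree p) = 0 :=
      Ideal.Quotient.eq_zero_iff_mem.2 h1
    have h3 := hom_aeval φ (zc A) (homog p.totalDegree p)
    rw [aeval_zc, h2, map_zero, homog_eval _ _ le_rfl _ h0] at h3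
    exact (mul_eq_zero.1 h3.symm).resolve_left (pow_ne_zero _ h0)
  have hS' : ∀ p ∈ S, p ∈ vanishIdeal A := fun p hp => (mem_vanish A p).2 fun z hz => by
    rw [hS] at hz; exact hz p hp
  have : WithLp.toLp 2 (fun i : Fin N => φ (zc A i.succ) / φ (zc A 0)) ∈
      {z : EuclideanSpace ℂ (Fin N) | ∀ p ∈ S, evalAt z p = 0} := fun p hp => key p (hS' p hp)
  rw [← hS] at this
  exact this

lemma growth (halg : IsAlgebraicSet A) (hprime : (vanishIdeal A).IsPrime)
    (a : EuclideanSpace ℂ (Fin N)) (ha : a ∈ A) (δ : ℝ) (hδ : 0 < δ) :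
    ∃ C : ℝ, 1 ≤ C ∧ ∀ q : MvPolynomial (Fin N) ℂ, 1 ≤ q.totalDegree →
      (∀ w ∈ A ∩ closedBall a δ, ‖evalAt w q‖ ≤ 1) →
      ∀ z ∈ A, ‖evalAt z q‖ ≤ (C * (1 + ‖z‖)) ^ q.totalDegree := by
  have : IsDomain (MvPolynomial (Fin N) ℂ ⧸ vanishIdeal A) := Ideal.Quotient.isDomain _
  have : (RingHom.ker (Psi A)).IsPrime := RingHom.ker_isPrime _
  have : IsDomain (Cone A) := Ideal.Quotient.isDomain _
  set v0 : Fin (N + 1) → ℂ := Fin.cons 1 (fun i => a i) with hv0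
  have hev : ∀ᶠ v : Fin (N + 1) → ℂ in 𝓝 v0, v 0 ≠ 0 ∧ ‖v 0‖ < 2 ∧
      ‖WithLp.toLp 2 (fun i : Fin N => v i.succ / v 0) - a‖ < δ := by
    have hc0 : Tendsto (fun v : Fin (N + 1) → ℂ => v 0) (𝓝 v0) (𝓝 1) :=
      (continuous_apply (0 : Fin (N + 1))).tendsto v0
    refine (hc0.eventually_ne one_ne_zero).and ((hc0.norm.eventually_lt_const (by simp)).and ?_)
    have hc : Tendsto (fun v : Fin (N + 1) → ℂ =>
        (WithLp.toLp 2 (fun i : Fin N => v i.succ / v 0) : EuclideanSpace ℂ (Fin N))) (𝓝 v0)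
        (𝓝 (WithLp.toLp 2 (fun i : Fin N => a i / 1))) := by
      refine ((PiLp.continuous_toLp 2 _).tendsto _).comp (tendsto_pi_nhds.2 fun i => ?_)
      exact ((continuous_apply i.succ).tendsto v0).div hc0 one_ne_zero
    have ha' : (WithLp.toLp 2 (fun i : Fin N => a i / 1) : EuclideanSpace ℂ (Fin N)) = a := by
      ext i; simp
    rw [ha'] at hc
    have := (hc.sub_const a).norm
    rw [sub_self, norm_zero] at this
    exact this.eventually_lt_const hδ
  obtain ⟨δ', hδ', hball⟩ := Metric.eventually_nhds_iff_ball.1 hev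
  obtain ⟨C1, hC1, hL⟩ := thmL (zc A) (adjoin_zc A) (pt A a ha 1) δ' hδ' 1
  refine ⟨2 * C1, by linarith, fun q hq1 hq z hz => ?_⟩
  set n := q.totalDegree with hn
  have hnorm2 : ‖((2 : ℂ)⁻¹) ^ n‖ = ((2 : ℝ)⁻¹) ^ n := by simp
  have hz1 : 0 < 1 + ‖z‖ := by positivity
  set τ : ℂ := (((1 + ‖z‖)⁻¹ : ℝ) : ℂ) with hτ
  have hτn : ‖τ‖ = (1 + ‖z‖)⁻¹ := by
    rw [hτ, Complex.norm_real, Real.norm_of_nonneg (by positivity)]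
  have hτ0 : τ ≠ 0 := by rw [← norm_pos_iff, hτn]; positivity
  have h := hL n hq1 (C (((2 : ℂ)⁻¹) ^ n) * homog n q) (by
      refine (MvPolynomial.totalDegree_mul _ _).trans ?_
      rw [MvPolynomial.totalDegree_C, zero_add]; exact homog_degree n q le_rfl)
    (by
      intro φ hφ
      obtain ⟨h1, h2, h3⟩ := hball (fun j => φ (zc A j)) (by
        rw [mem_ball, dist_pi_lt_iff hδ']
        intro j
        rw [dist_eq_norm]
        convert hφ j using 2
        congr 1
        refine Fin.cases ?_ (fun i => ?_) j
        · rw [pt_zero]; rfl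
        · rw [pt_succ, one_mul]; rfl)
      have hmem := hq _ ⟨point_mem A halg φ h1, by
        rw [mem_closedBall, dist_eq_norm]; exact h3.le⟩
      rw [hom_aeval, map_mul, eval_C, norm_mul, hnorm2, homog_eval n q le_rfl _ h1, norm_mul, norm_pow]
      calc ((2 : ℝ)⁻¹) ^ n * (‖φ (zc A 0)‖ ^ n * ‖eval (fun i : Fin N => φ (zc A i.succ) / φ (zc A 0)) q‖)
          ≤ ((2 : ℝ)⁻¹) ^ n * (2 ^ n * 1) := by
            gcongr
            exact hmem
        _ = 1 := by rw [mul_one, ← mul_pow]; norm_num)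
    (pt A z hz τ) (by
      intro j
      refine Fin.cases ?_ (fun i => ?_) j
      · rw [pt_zero, hτn]
        exact inv_le_one_of_one_le₀ (by linarith [norm_nonneg z])
      · rw [pt_succ, norm_mul, hτn, inv_mul_le_iff₀ hz1]
        linarith [PiLp.norm_apply_le z i])
  rw [hom_aeval, map_mul, eval_C, norm_mul, hnorm2, homog_eval n q le_rfl _ (by rw [pt_zero]; exact hτ0),
    norm_mul, norm_pow, pt_zero, hτn] at h
  have h5 : (fun i : Fin N => pt A z hz τ (zc A i.succ) / τ) = fun i => z i := by
    ext i; rw [pt_succ, mul_div_cancel_left₀ _ hτ0]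
  rw [h5, ← mul_assoc, ← mul_pow, ← mul_inv, inv_pow, inv_mul_le_iff₀ (by positivity), ← mul_pow] at h
  unfold evalAt
  refine h.trans (le_of_eq ?_)
  congr 1; ring
end cone

lemma alg_closed {N : ℕ} {A : Set (EuclideanSpace ℂ (Fin N))} (halg : IsAlgebraicSet A) :
    IsClosed A := by
  obtain ⟨S, rfl⟩ := halg
  have : {z : EuclideanSpace ℂ (Fin N) | ∀ p ∈ S, evalAt z p = 0} =
      ⋂ p ∈ S, {z | evalAt z p = 0} := by ext; simp
  rw [this]
  refine isClosed_biInter fun p _ => isClosed_eq ?_ continuous_const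
  unfold evalAt
  exact (continuous_eval' p).comp (continuous_pi fun i => by fun_prop)

lemma holo_cont {N M : ℕ} {f : EuclideanSpace ℂ (Fin N) → EuclideanSpace ℂ (Fin M)}
    {A : Set (EuclideanSpace ℂ (Fin N))} (h : IsHoloOn f A) : ContinuousOn f A := by
  intro z hz
  obtain ⟨U, hU, hzU, F, hF, hfF⟩ := h z hz
  have h1 : ContinuousWithinAt F A z :=
    (hF.continuousOn.continuousAt (hU.mem_nhds hzU)).continuousWithinAt
  refine h1.congr_of_eventuallyEq ?_ (hfF ⟨hzU, hz⟩)
  filter_upwards [mem_nhdsWithin_of_mem_nhds (hU.mem_nhds hzU), self_mem_nhdsWithin] with w h2 h3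
  exact hfF ⟨h2, h3⟩

lemma green_upper {N : ℕ} (K : Set (EuclideanSpace ℂ (Fin N))) (z : EuclideanSpace ℂ (Fin N))
    (T : ℝ) (hT : 1 ≤ T) (h : ∀ q : MvPolynomial (Fin N) ℂ, 1 ≤ q.totalDegree →
      (∀ w ∈ K, ‖evalAt w q‖ ≤ 1) → ‖evalAt z q‖ ≤ T ^ q.totalDegree) :
    greenV K z ≤ ((Real.log T : ℝ) : EReal) := by
  unfold greenV
  refine sSup_le ?_
  rintro x ⟨q, h1, h2, rfl⟩
  rw [EReal.coe_le_coe_iff]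
  have hq := h q h1 h2
  have hn : (0 : ℝ) < q.totalDegree := by exact_mod_cast h1
  rw [inv_mul_le_iff₀ hn]
  have hlT := Real.log_nonneg hT
  refine max_le ?_ (by positivity)
  by_cases h0 : ‖evalAt z q‖ = 0
  · rw [h0, Real.log_zero]; positivity
  · rw [← Real.log_pow]
    exact Real.log_le_log (lt_of_le_of_ne (norm_nonneg _) (Ne.symm h0)) hq

lemma green_lower {M : ℕ} (K : Set (EuclideanSpace ℂ (Fin M))) (w : EuclideanSpace ℂ (Fin M))
    (R : ℝ) (hR : 0 < R) (hK : ∀ y ∈ K, ‖y‖ ≤ R) (j : Fin M) :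
    ((Real.log (‖w j‖ / R) : ℝ) : EReal) ≤ greenV K w := by
  have hR0 : ((R : ℂ)⁻¹) ≠ 0 := by simp [hR.ne']
  have hRn : ‖(R : ℂ)⁻¹‖ = R⁻¹ := by
    rw [norm_inv, Complex.norm_real, Real.norm_of_nonneg hR.le]
  have hdeg : (C ((R : ℂ)⁻¹) * X j : MvPolynomial (Fin M) ℂ).totalDegree = 1 := by
    rw [MvPolynomial.C_mul_X_eq_monomial, MvPolynomial.totalDegree_monomial _ hR0]
    simp
  have hval : ∀ y : EuclideanSpace ℂ (Fin M), ‖evalAt y (C ((R : ℂ)⁻¹) * X j)‖ = ‖y j‖ / R := by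
    intro y
    unfold evalAt
    rw [map_mul, eval_C, eval_X, norm_mul, hRn, inv_mul_eq_div]
  refine le_trans ?_ (le_sSup ⟨C ((R : ℂ)⁻¹) * X j, hdeg.ge, fun y hy => ?_, rfl⟩)
  · rw [hval, hdeg, EReal.coe_le_coe_iff]
    simp
  · rw [hval, div_le_one hR]
    exact (PiLp.norm_apply_le y j).trans (hK y hy)

lemma limsup_aux {N M : ℕ} (f : EuclideanSpace ℂ (Fin N) → EuclideanSpace ℂ (Fin M))
    (A : Set (EuclideanSpace ℂ (Fin N))) (d K : ℝ)
    (h : ∀ z ∈ A, 1 < ‖z‖ → f z ≠ 0 → Real.log ‖f z‖ ≤ K + d * Real.log ‖z‖) :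
    growthExp f A ≤ (d : EReal) := by
  refine le_of_forall_gt fun c hc => ?_
  obtain ⟨c', hdc, hcc⟩ := EReal.lt_iff_exists_real_btwn.1 hc
  rw [EReal.coe_lt_coe_iff] at hdc
  refine lt_of_le_of_lt ?_ hcc
  unfold growthExp
  refine Filter.limsup_le_of_le (by isBoundedDefault) ?_
  unfold atInftyOn
  have ht : Tendsto (fun z : EuclideanSpace ℂ (Fin N) => Real.log ‖z‖)
      (Filter.comap (fun z => ‖z‖) Filter.atTop) atTop :=
    Real.tendsto_log_atTop.comp tendsto_comap
  have ht1 : Tendsto (fun z : EuclideanSpace ℂ (Fin N) => ‖z‖)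
      (Filter.comap (fun z => ‖z‖) Filter.atTop) atTop := tendsto_comap
  rw [Filter.eventually_inf_principal]
  filter_upwards [ht.eventually_ge_atTop (K / (c' - d)), ht1.eventually_gt_atTop 1] with z h1 h2 hz
  have hlog := Real.log_pos h2
  have hz0 : ‖z‖ ≠ 0 := by linarith
  unfold logRatio elog
  rw [if_neg hz0]
  by_cases hf : f z = 0
  · rw [if_pos (by rw [hf, norm_zero]), EReal.bot_div_of_pos_ne_top (by exact_mod_cast hlog) (EReal.coe_ne_top _)]
    exact bot_le
  · rw [if_neg (norm_ne_zero_iff.2 hf), ← EReal.coe_div, EReal.coe_le_coe_iff, div_le_iff₀ hlog]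
    have h3 := h z hz h2 hf
    rw [div_le_iff₀ (by linarith)] at h1
    nlinarith

end BW
end

/-- Let `𝒜 ⊆ ℂᴺ` be an irreducible algebraic set of positive dimension
(equiv., infinite) and `f : 𝒜 → ℂᴹ` a proper holomorphic mapping on `𝒜`. Let `a ∈ 𝒜`,
`δ > 0` and `E := 𝒜 ∩ B̄(a,δ)`. If `V_{f(E)} ∘ f ≤ d · V_E` on `𝒜` for some `d > 0`, then
`ρ(f,𝒜) = limsup_{𝒜 ∋ z → ∞} log ‖f z‖ / log ‖z‖ ≤ d`. -/
theorem statement16 {N M : ℕ} (A : Set (EuclideanSpace ℂ (Fin N)))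
    (f : EuclideanSpace ℂ (Fin N) → EuclideanSpace ℂ (Fin M))
    (halg : IsAlgebraicSet A) (hprime : (vanishIdeal A).IsPrime) (hinf : A.Infinite)
    (hholo : IsHoloOn f A)
    (hproper : ∀ K : Set (EuclideanSpace ℂ (Fin M)), IsCompact K → IsCompact (A ∩ f ⁻¹' K))
    (a : EuclideanSpace ℂ (Fin N)) (ha : a ∈ A) (δ : ℝ) (hδ : 0 < δ)
    (d : ℝ) (hd : 0 < d)
    (hineq : ∀ z ∈ A,
      greenV (f '' (A ∩ Metric.closedBall a δ)) (f z) ≤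
        (d : EReal) * greenV (A ∩ Metric.closedBall a δ) z) :
    growthExp f A ≤ (d : EReal) := by
  obtain ⟨C1, hC1, hgr⟩ := BW.growth A halg hprime a ha δ hδ
  have hcomp : IsCompact (A ∩ closedBall a δ) :=
    (isCompact_closedBall a δ).inter_left (BW.alg_closed halg)
  obtain ⟨R0, hR0⟩ := hcomp.exists_bound_of_continuousOn
    ((BW.holo_cont hholo).mono Set.inter_subset_left)
  set R := max R0 1 with hRdef
  have hR : 0 < R := lt_of_lt_of_le one_pos (le_max_right _ _)
  have hK : ∀ y ∈ f '' (A ∩ closedBall a δ), ‖y‖ ≤ R := by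
    rintro y ⟨w, hw, rfl⟩
    exact (hR0 w hw).trans (le_max_left _ _)
  -- bound for the components
  have hcoord : ∀ z ∈ A, ∀ j, ‖f z j‖ ≤ R * Real.exp (d * Real.log (C1 * (1 + ‖z‖))) := by
    intro z hz j
    have hT : 1 ≤ C1 * (1 + ‖z‖) := by nlinarith [norm_nonneg z]
    have hup := BW.green_upper (A ∩ closedBall a δ) z (C1 * (1 + ‖z‖)) hT
      fun q h1 h2 => hgr q h1 h2 z hz
    have hlow := BW.green_lower (f '' (A ∩ closedBall a δ)) (f z) R hR hK j
    have h1 : (d : EReal) * greenV (A ∩ closedBall a δ) z ≤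
        (d : EReal) * ((Real.log (C1 * (1 + ‖z‖)) : ℝ) : EReal) :=
      mul_le_mul_of_nonneg_left hup (by exact_mod_cast hd.le)
    have h2 := (hlow.trans (hineq z hz)).trans h1
    rw [← EReal.coe_mul, EReal.coe_le_coe_iff] at h2
    by_cases h0 : f z j = 0
    · rw [h0, norm_zero]; positivity
    · have h3 : 0 < ‖f z j‖ / R := div_pos (norm_pos_iff.2 h0) hR
      rw [Real.log_le_iff_le_exp h3, div_le_iff₀ hR] at h2
      linarith
  refine BW.limsup_aux f A d (Real.log ((M + 1) * R) + d * Real.log (2 * C1)) fun z hz hz1 hfz => ?_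
  have hexp := Real.exp_pos (d * Real.log (C1 * (1 + ‖z‖)))
  have hM : (0 : ℝ) < (M : ℝ) + 1 := by positivity
  have hsum : ‖f z‖ ≤ ((M + 1) * R) * Real.exp (d * Real.log (C1 * (1 + ‖z‖))) := by
    have h1 : f z = ∑ j, EuclideanSpace.single j (f z j) := by
      ext i
      simp [Finset.sum_apply, Pi.single_apply]
    have h2 : ‖f z‖ ≤ ∑ j : Fin M, ‖f z j‖ := by
      conv_lhs => rw [h1]
      refine (norm_sum_le _ _).trans (le_of_eq ?_)
      simp
    refine h2.trans ((Finset.sum_le_sum fun j _ => hcoord z hz j).trans ?_)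
    rw [Finset.sum_const, Finset.card_univ, Fintype.card_fin, nsmul_eq_mul]
    nlinarith [mul_pos hR hexp]
  have hlogle := Real.log_le_log (norm_pos_iff.2 hfz) hsum
  rw [Real.log_mul (by positivity) hexp.ne', Real.log_exp] at hlogle
  have h4 : Real.log (C1 * (1 + ‖z‖)) ≤ Real.log (2 * C1) + Real.log ‖z‖ := by
    rw [← Real.log_mul (by positivity) (by positivity)]
    refine Real.log_le_log (by positivity) ?_
    nlinarith
  nlinarith [mul_le_mul_of_nonneg_left h4 hd.le]
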